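/- arXiv:0911.4370 — 2 statements merged into one kernel-verified Lean document; each statement's English description precedes it below -/
import Mathlib

section
/- Let q be an odd prime power. A Kakeya set K = ⋃_d L_d in AG(2,q) satisfies |K| = q(q+1)/2 + (q−1)/2 if and only if there is a direction d₀ such that no point of AG(2,q) lies on three or more of the lines L_d with d ≠ d₀ (equivalently, these q lines, together with the line at infinity, form a dual oval in PG(2,q), so that K is a Kakeya set of the type K(O, ℓ, ℓ_A) associated to a dual oval O, one of its lines ℓ, and an extra line ℓ_A). -/
/-- `L` is an affine line in `AG(2,q) = F × F` with direction `d`, where the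
`q+1` directions are indexed by `Option F`: `some m` is the parallel class of
lines of slope `m`, and `none` is the parallel class of vertical lines. -/
def IsLineWithDir {F : Type*} [Field F] (d : Option F) (L : Set (F × F)) : Prop :=
  match d with
  | none => ∃ c : F, L = {p : F × F | p.1 = c}
  | some m => ∃ b : F, L = {p : F × F | p.2 = m * p.1 + b}

set_option linter.all false

namespace Kak

theorem fin_scalar {F : Type*} [Field F] (h2 : (2:F) ≠ 0) (X Y p r dv dw ω : F)
    (e0 : 2*ω = dv*Y - X*dw) (e2 : ω*(p+r+4) = dv - dw)
    (e3 : (dw+p*ω)*(X*(p^2+4*p-r^2)-2*p) = p*(X*(p-r+4)-2)*dv)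
    (e3' : (dv-r*ω)*(Y*(r^2+4*r-p^2)-2*r) = r*(Y*(r-p+4)-2)*dw)
    (e4 : dv^2*(p+4) = X*(X*(p+4)-2)) (e4' : dw^2*(r+4) = Y*(Y*(r+4)-2))
    (hX : X ≠ 0) (hY : Y ≠ 0) (hp : p ≠ 0) (hr : r ≠ 0) (hP : p+4 ≠ 0) (hQ : r+4 ≠ 0)
    (hdv : dv ≠ 0) (hdw : dw ≠ 0) (hω : ω ≠ 0) : False := by
  have h4 : (4:F) ≠ 0 := by
    have : (4:F) = 2*2 := by norm_num
    rw [this]; exact mul_ne_zero h2 h2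
  have k : dv*(2-Y*(p+r+4)) = dw*(2-X*(p+r+4)) := by
    linear_combination (-2)*e2 + (p+r+4)*e0
  by_cases hx : 2-X*(p+r+4) = 0
  · have hy : 2-Y*(p+r+4) = 0 := by
      rw [hx, mul_zero] at k
      exact (mul_eq_zero.mp k).resolve_left hdv
    have hT : p+r+4 ≠ 0 := by
      intro h; rw [h] at hx; simp at hx; exact h2 hx
    have hXY : X = Y := by
      apply mul_right_cancel₀ hT; linear_combination hy - hx
    subst hXY
    have hX2 : X*(p+r+4) = 2 := by linear_combination -hx
    -- B*(T) = -2 r (r+p), D1*T = -4 r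
    have hB : (X*(p^2+4*p-r^2)-2*p)*(p+r+4) = -2*r*(r+p) := by
      linear_combination (p^2+4*p-r^2)*hX2
    have hD : (X*(p-r+4)-2)*(p+r+4) = -4*r := by
      linear_combination (p-r+4)*hX2
    have hB' : (X*(r^2+4*r-p^2)-2*r)*(p+r+4) = -2*p*(r+p) := by
      linear_combination (r^2+4*r-p^2)*hX2
    have hD' : (X*(r-p+4)-2)*(p+r+4) = -4*p := by
      linear_combination (r-p+4)*hX2
    have f1 : (dw+p*ω)*(r+p) = 2*p*dv := by
      have : r*2*((dw+p*ω)*(r+p)) = r*2*(2*p*dv) := by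
        linear_combination (-(p+r+4))*e3 + (dw+p*ω)*hB - p*dv*hD
      exact mul_left_cancel₀ (mul_ne_zero hr h2) this
    have f2 : (dv-r*ω)*(r+p) = 2*r*dw := by
      have : p*2*((dv-r*ω)*(r+p)) = p*2*(2*r*dw) := by
        linear_combination (-(p+r+4))*e3' + (dv-r*ω)*hB' - r*dw*hD'
      exact mul_left_cancel₀ (mul_ne_zero hp h2) this
    -- eliminate ω
    have f1' : dw*(r+4)*(p+r) = dv*p*(p+r+8) := by
      linear_combination (p+r+4)*f1 - p*(r+p)*e2
    have f2' : dv*(p+4)*(p+r) = dw*r*(p+r+8) := by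
      linear_combination (p+r+4)*f2 + r*(r+p)*e2
    have f3 : (p-r)^2 = 0 := by
      have : (dv*dw*4*(p+r+4))*(p-r)^2 = 0 := by
        linear_combination (dv*(p+4)*(p+r))*f1' + (dv*p*(p+r+8))*f2'
      exact (mul_eq_zero.mp this).resolve_left
        (mul_ne_zero (mul_ne_zero (mul_ne_zero hdv hdw) h4) hT)
    have f4 : p = r := by
      have := pow_eq_zero_iff (two_ne_zero) |>.mp f3
      linear_combination this
    subst f4
    have f5 : dv = dw := by
      have : (2*p*(p+4))*(dv-dw) = 0 := by linear_combination -f1'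
      have := (mul_eq_zero.mp this).resolve_left (mul_ne_zero (mul_ne_zero h2 hp) hP)
      linear_combination this
    subst f5
    have : 2*ω = 0 := by rw [e0]; ring
    exact hω ((mul_eq_zero.mp this).resolve_left h2)
  · have o : ω*(2-X*(p+r+4)) = dv*(Y-X) := by
      apply mul_left_cancel₀ h2
      linear_combination (2-X*(p+r+4))*e0 + X*k
    have hy : 2-Y*(p+r+4) ≠ 0 := by
      intro h; rw [h, mul_zero] at k
      exact (mul_ne_zero hdw hx) k.symm
    have o' : ω*(2-Y*(p+r+4)) = dw*(Y-X) := by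
      apply mul_left_cancel₀ h2
      linear_combination (2-Y*(p+r+4))*e0 + Y*k
    have a1 : (2-Y*(p+r+4)+p*(Y-X))*(X*(p^2+4*p-r^2)-2*p)
        = p*(X*(p-r+4)-2)*(2-X*(p+r+4)) := by
      apply mul_left_cancel₀ hdv
      linear_combination (2-X*(p+r+4))*e3 + (X*(p^2+4*p-r^2)-2*p)*(k - p*o)
    have a2 : (2-X*(p+r+4)-r*(Y-X))*(Y*(r^2+4*r-p^2)-2*r)
        = r*(Y*(r-p+4)-2)*(2-Y*(p+r+4)) := by
      apply mul_left_cancel₀ hdw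
      linear_combination (2-Y*(p+r+4))*e3' + (Y*(r^2+4*r-p^2)-2*r)*(r*o'-k)
    obtain ⟨ξ, hξ⟩ : ∃ ξ, ξ = X*(p+4) := ⟨_, rfl⟩
    obtain ⟨η, hη⟩ : ∃ η, η = Y*(r+4) := ⟨_, rfl⟩
    have hξ2 : ξ - 2 ≠ 0 := by
      intro h
      have : dv^2*(p+4) = 0 := by rw [e4, ← hξ, h, mul_zero]
      exact (mul_ne_zero (pow_ne_zero 2 hdv) hP) this
    have hη2 : η - 2 ≠ 0 := by
      intro h
      have : dw^2*(r+4) = 0 := by rw [e4', ← hη, h, mul_zero]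
      exact (mul_ne_zero (pow_ne_zero 2 hdw) hQ) this
    have hξ0 : ξ ≠ 0 := by rw [hξ]; exact mul_ne_zero hX hP
    have hη0 : η ≠ 0 := by rw [hη]; exact mul_ne_zero hY hQ
    have A : p^2*η*(ξ-2) - r^2*ξ*(η-2) + 4*p*(ξ-2)*(η-ξ) = 0 := by
      subst hξ hη
      linear_combination (-(p+4))*a1
    have B : r^2*ξ*(η-2) - p^2*η*(ξ-2) + 4*r*(η-2)*(ξ-η) = 0 := by
      subst hξ hη
      linear_combination (-(r+4))*a2
    have V : ξ*(ξ-2)*(2*(r+4)-η*(p+r+4))^2 = η*(η-2)*(2*(p+4)-ξ*(p+r+4))^2 := by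
      have e5 : ξ*(ξ-2) = dv^2*(p+4)^2 := by rw [hξ]; linear_combination (-(p+4))*e4
      have e6 : η*(η-2) = dw^2*(r+4)^2 := by rw [hη]; linear_combination (-(r+4))*e4'
      have e7 : 2*(r+4)-η*(p+r+4) = (r+4)*(2-Y*(p+r+4)) := by rw [hη]; ring
      have e8 : 2*(p+4)-ξ*(p+r+4) = (p+4)*(2-X*(p+r+4)) := by rw [hξ]; ring
      rw [e5, e6, e7, e8]
      linear_combination (p+4)^2*(r+4)^2*(dv*(2-Y*(p+r+4)) + dw*(2-X*(p+r+4)))*k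
    have S : (η-ξ)*(p*(ξ-2)-r*(η-2)) = 0 := by
      apply mul_left_cancel₀ h4
      linear_combination A + B
    have same : ξ = η → p = r → False := by
      intro h h'
      subst h'
      have hXY : X = Y := by
        apply mul_right_cancel₀ hP; rw [← hξ, ← hη, h]
      subst hXY
      have : ω = 0 := by
        rw [sub_self, mul_zero] at o
        exact (mul_eq_zero.mp o).resolve_right hx
      exact hω this
    rcases mul_eq_zero.mp S with h | h
    · have h1 : η = ξ := by linear_combination h
      subst h1
      have : (η*(η-2))*((p-r)*(p+r)) = 0 := by linear_combination A
      have := (mul_eq_zero.mp this).resolve_left (mul_ne_zero hξ0 hξ2)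
      rcases mul_eq_zero.mp this with h | h
      · exact same rfl (by linear_combination h)
      · have h1 : r = -p := by linear_combination h
        subst h1
        have : (η*(η-2))*(4*4*2*p*(η-2)) = 0 := by linear_combination V
        have := (mul_eq_zero.mp this).resolve_left (mul_ne_zero hξ0 hξ2)
        exact mul_ne_zero (mul_ne_zero (mul_ne_zero (mul_ne_zero h4 h4) h2) hp) hξ2 this
    · obtain ⟨m, hm⟩ : ∃ m, m = (ξ-2)/r := ⟨_, rfl⟩
      have m1 : ξ = 2 + r*m := by rw [hm]; field_simp; ring
      have m2 : η = 2 + p*m := by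
        apply mul_left_cancel₀ hr
        rw [m1] at h
        linear_combination -h
      have hm0 : m ≠ 0 := by
        intro h0; apply hξ2; rw [m1, h0]; ring
      have : (p*r*m)*((p-r)*(2+m*(p+r+4))) = 0 := by
        rw [m1, m2] at A; linear_combination A
      have := (mul_eq_zero.mp this).resolve_left (mul_ne_zero (mul_ne_zero hp hr) hm0)
      rcases mul_eq_zero.mp this with h | h
      · have : p = r := by linear_combination h
        exact same (by rw [m1, m2, this]) this
      · apply hx
        apply mul_left_cancel₀ hP
        rw [mul_zero]
        have : ξ = X*(p+4) := hξ
        linear_combination (-(p+r+4))*m1 + (p+r+4)*hξ  - r*h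
end Kak

namespace Kak

def wd {F : Type*} [Field F] (x y : F × F) : F := x.1*y.2 - x.2*y.1

/-- the Segre-type condition between two lines with one triple and one single point -/
def Cond {F : Type*} [Field F] (a c v : F × F) : Prop :=
  wd a c * (wd a v + wd c v) = -2 * wd a v * wd c v ∧ wd a v ≠ 0 ∧ wd c v ≠ 0

theorem Cond.symm {F : Type*} [Field F] {a c v : F × F} (h : Cond a c v) : Cond c a (-v) := by
  obtain ⟨h1, h2, h3⟩ := h
  simp only [Cond, wd, Prod.fst_neg, Prod.snd_neg] at *
  refine ⟨by linear_combination h1, ?_, ?_⟩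
  · intro h; apply h3; linear_combination -h
  · intro h; apply h2; linear_combination -h

/-- coordinate version: one line -/
theorem coordA {F : Type*} [Field F] (h2 : (2:F) ≠ 0) {v1 v2 c1 c2 γ : F}
    (hγ : γ = c1*v2 - c2*v1) (e1 : c2*(v2+γ) = -2*v2*γ) (e2 : c1*(γ-v1) = -2*v1*γ)
    (hv1 : v1 ≠ 0) (hv2 : v2 ≠ 0) (hg : γ ≠ 0) :
    v1 + v2 ≠ 0 ∧ γ^2 = (v1-v2)*γ + v1*v2*(1-2*(v1+v2)) ∧
    c1*v2*(v1+v2) = v1*(γ+v2*(1-2*(v1+v2))) ∧ c2*v1*(v1+v2) = v2*(v1*(1-2*(v1+v2))-γ) := by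
  have k : (v2+γ)*(γ-v1) = -2*v1*v2*(v1+v2) := by
    apply mul_left_cancel₀ hg
    linear_combination (v2+γ)*(γ-v1)*hγ + v2*(v2+γ)*e2 - v1*(γ-v1)*e1
  have hX : v1 + v2 ≠ 0 := by
    intro h
    rw [h, mul_zero] at k
    rcases mul_eq_zero.mp k with k | k
    · rw [k, mul_zero] at e1
      exact mul_ne_zero (mul_ne_zero (neg_ne_zero.mpr h2) hv2) hg e1.symm
    · rw [k, mul_zero] at e2
      exact mul_ne_zero (mul_ne_zero (neg_ne_zero.mpr h2) hv1) hg e2.symm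
  refine ⟨hX, by linear_combination k, ?_, ?_⟩
  · apply mul_left_cancel₀ (mul_ne_zero h2 hv1)
    linear_combination (-(v2+γ))*e2 + c1 * k + 2*v1*k
  · apply mul_left_cancel₀ (mul_ne_zero h2 hv2)
    linear_combination (-(γ-v1))*e1 + c2 * k + 2*v2*k

/-- coordinate version: two lines through the same point -/
theorem coordB {F : Type*} [Field F] (h2 : (2:F) ≠ 0) {v1 v2 c1 c2 γ d1 d2 δ : F}
    (hγ : γ = c1*v2 - c2*v1) (e1 : c2*(v2+γ) = -2*v2*γ) (e2 : c1*(γ-v1) = -2*v1*γ)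
    (hδ : δ = d1*v2 - d2*v1) (e3 : d2*(v2+δ) = -2*v2*δ) (e4 : d1*(δ-v1) = -2*v1*δ)
    (hv1 : v1 ≠ 0) (hv2 : v2 ≠ 0) (hg : γ ≠ 0) (hd : δ ≠ 0) (hcd : c1*d2 - c2*d1 ≠ 0) :
    γ ≠ δ ∧ γ + δ = v1 - v2 ∧ γ*δ = -(v1*v2*(1-2*(v1+v2))) ∧
    v2*(c1+d1+1+4*v1) = v1+v2 ∧ v1*(c2+d2+1+4*v2) = v1+v2 ∧
    (c1-d1)*(v2*(v1+v2)) = (γ-δ)*v1 ∧ (c2-d2)*(v1*(v1+v2)) = -(γ-δ)*v2 := by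
  obtain ⟨hX, q1, p1, p2⟩ := coordA h2 hγ e1 e2 hv1 hv2 hg
  obtain ⟨-, q2, p3, p4⟩ := coordA h2 hδ e3 e4 hv1 hv2 hd
  have hne : γ ≠ δ := by
    rintro h
    rw [← h] at p3 p4
    have a1 : c1 = d1 := by
      apply mul_right_cancel₀ (mul_ne_zero hv2 hX); linear_combination p1 - p3
    have a2 : c2 = d2 := by
      apply mul_right_cancel₀ (mul_ne_zero hv1 hX); linear_combination p2 - p4
    apply hcd; rw [a1, a2]; ring
  have hs : γ + δ = v1 - v2 := by
    apply mul_left_cancel₀ (sub_ne_zero.mpr hne); linear_combination q1 - q2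
  refine ⟨hne, hs, ?_, ?_, ?_, ?_, ?_⟩
  · linear_combination γ * hs - q1
  · apply mul_left_cancel₀ hX; linear_combination p1 + p3 + v1 * hs
  · apply mul_left_cancel₀ hX; linear_combination p2 + p4 - v2 * hs
  · linear_combination p1 - p3
  · linear_combination p2 - p4

structure Pr {F : Type*} [Field F] (a b c d v : F × F) : Prop where
  ac : Cond a c v
  ad : Cond a d v
  bc : Cond b c v
  bd : Cond b d v
  ab : wd a b ≠ 0
  cd : wd c d ≠ 0

theorem Pr.symm {F : Type*} [Field F] {a b c d v : F × F} (h : Pr a b c d v) :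
    Pr c d a b (-v) :=
  ⟨h.ac.symm, h.bc.symm, h.ad.symm, h.bd.symm, h.cd, h.ab⟩

/-- express a vector in a basis -/
theorem basis {F : Type*} [Field F] {a b : F × F} (h : wd a b ≠ 0) (x : F × F) :
    ∃ x1 x2 : F, x = (x1*a.1 + x2*b.1, x1*a.2+x2*b.2) := by
  refine ⟨wd x b / wd a b, wd a x / wd a b, ?_⟩
  ext
  · simp only; field_simp; simp only [wd]; ring
  · simp only; field_simp; simp only [wd]; ring

theorem cond_basis {F : Type*} [Field F] {a b : F × F} (h : wd a b ≠ 0) {v1 v2 c1 c2 : F}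
    (hc : Cond a (c1*a.1 + c2*b.1, c1*a.2+c2*b.2) (v1*a.1 + v2*b.1, v1*a.2+v2*b.2))
    (hc' : Cond b (c1*a.1 + c2*b.1, c1*a.2+c2*b.2) (v1*a.1 + v2*b.1, v1*a.2+v2*b.2)) :
    c2*(v2+(c1*v2-c2*v1)) = -2*v2*(c1*v2-c2*v1) ∧ c1*((c1*v2-c2*v1)-v1) = -2*v1*(c1*v2-c2*v1)
    ∧ v1 ≠ 0 ∧ v2 ≠ 0 ∧ c1*v2-c2*v1 ≠ 0 := by
  obtain ⟨h1, h2, h3⟩ := hc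
  obtain ⟨h4, h5, h6⟩ := hc'
  simp only [wd] at *
  refine ⟨?_, ?_, ?_, ?_, ?_⟩
  · apply mul_left_cancel₀ (pow_ne_zero 2 h); linear_combination h1
  · apply mul_left_cancel₀ (pow_ne_zero 2 h); linear_combination -h4
  · rintro rfl; apply h5; ring
  · rintro rfl; apply h2; ring
  · intro hh; apply h3; linear_combination (a.1*b.2-a.2*b.1)*hh

/-- Nucleus lemma -/
theorem nucleus_alg {F : Type*} [Field F] (h2 : (2:F) ≠ 0) {a b c v : F × F} (h : wd a b ≠ 0)
    (hc : Cond a c v) (hc' : Cond b c v)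
    (hM : wd (b - a) (v + v + c - a) = 0) : wd (a+b) v = 0 := by
  obtain ⟨v1, v2, rfl⟩ := basis h v
  obtain ⟨c1, c2, rfl⟩ := basis h c
  obtain ⟨e1, e2, n1, n2, n3⟩ := cond_basis h hc hc'
  obtain ⟨hX, q, p1, p2⟩ := coordA h2 rfl e1 e2 n1 n2 n3
  have hM' : c1 + c2 = 1 - 2*(v1+v2) := by
    apply mul_left_cancel₀ h
    simp only [wd, Prod.fst_sub, Prod.snd_sub, Prod.fst_add, Prod.snd_add] at *
    linear_combination -hM
  have : (c1*v2-c2*v1) * (v1 - v2) = 0 := by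
    apply mul_left_cancel₀ hX
    linear_combination (-v1)*p1 + (-v2)*p2 + v1*v2*(v1+v2)*hM'
  have := (mul_eq_zero.mp this).resolve_left n3
  simp only [wd, Prod.fst_sub, Prod.snd_sub, Prod.fst_add, Prod.snd_add] at *
  linear_combination (-(a.1*b.2-a.2*b.1))*this

/-- ab-difference -/
theorem diff_ne {F : Type*} [Field F] (h2 : (2:F) ≠ 0) {a b c v : F × F} (h : wd a b ≠ 0)
    (hc : Cond a c v) (hc' : Cond b c v) : wd a v ≠ wd b v := by
  obtain ⟨v1, v2, rfl⟩ := basis h v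
  obtain ⟨c1, c2, rfl⟩ := basis h c
  obtain ⟨e1, e2, n1, n2, n3⟩ := cond_basis h hc hc'
  obtain ⟨hX, q, p1, p2⟩ := coordA h2 rfl e1 e2 n1 n2 n3
  intro hh
  apply hX
  apply mul_left_cancel₀ h
  simp only [wd, Prod.fst_sub, Prod.snd_sub, Prod.fst_add, Prod.snd_add] at *
  linear_combination hh

theorem Pr.G {F : Type*} [Field F] (h2 : (2:F) ≠ 0) {a b c d v : F × F} (h : Pr a b c d v) :
    (a.1+b.1+c.1+d.1+4*v.1) * (wd a v * wd b v) = -(wd a b * (wd a v - wd b v) * v.1) ∧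
    (a.2+b.2+c.2+d.2+4*v.2) * (wd a v * wd b v) = -(wd a b * (wd a v - wd b v) * v.2) := by
  obtain ⟨ac, ad, bc, bd, ab, cd⟩ := h
  obtain ⟨v1, v2, rfl⟩ := basis ab v
  obtain ⟨c1, c2, rfl⟩ := basis ab c
  obtain ⟨d1, d2, rfl⟩ := basis ab d
  obtain ⟨e1, e2, n1, n2, n3⟩ := cond_basis ab ac bc
  obtain ⟨e3, e4, -, -, n4⟩ := cond_basis ab ad bd
  have hcd : c1*d2-c2*d1 ≠ 0 := by
    intro hh; apply cd; simp only [wd]; linear_combination (a.1*b.2-a.2*b.1)*hh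
  obtain ⟨-, -, -, s1, s2, -, -⟩ := coordB h2 rfl e1 e2 rfl e3 e4 n1 n2 n3 n4 hcd
  simp only [wd]
  constructor
  · linear_combination (-((a.1*b.2-a.2*b.1)^2))*(v1*a.1*s1 + v2*b.1*s2)
  · linear_combination (-((a.1*b.2-a.2*b.1)^2))*(v1*a.2*s1 + v2*b.2*s2)

theorem Pr.sum {F : Type*} [Field F] (h2 : (2:F) ≠ 0) {a b c d v : F × F} (h : Pr a b c d v) :
    wd (a+b) v = - wd (c+d) v := by
  obtain ⟨g1, g2⟩ := h.G h2
  apply mul_right_cancel₀ (mul_ne_zero h.ac.2.1 h.bc.2.1)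
  simp only [wd, Prod.fst_add, Prod.snd_add] at *
  linear_combination v.2*g1 - v.1*g2
end Kak

namespace Kak

theorem std_pair {F : Type*} [Field F] (h2 : (2:F) ≠ 0) {v1 v2 c1 c2 d1 d2 : F}
    (h : Pr ((1:F),(0:F)) (0,1) (c1,c2) (d1,d2) (v1,v2)) :
    ∃ P κ : F, P ≠ 0 ∧ P - 4 ≠ 0 ∧ v1 ≠ 0 ∧ v2 ≠ 0 ∧ v1+v2 ≠ 0 ∧ 1-2*(v1+v2) ≠ 0 ∧
     2*v1*v2*P = v1+v2 ∧ 
     c1 + d1 = 2*(P-2)*v1 - 1 ∧ c2 + d2 = 2*(P-2)*v2 - 1 ∧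
     κ^2 = 2*v1*v2*(v1+v2)*(P-4) ∧ (c1-d1)*(v2*(v1+v2)) = κ*v1 ∧
     (c2-d2)*(v1*(v1+v2)) = -κ*v2 := by
  obtain ⟨ac, ad, bc, bd, ab, cd⟩ := h
  have A1 : Cond ((1:F),(0:F)) (c1*(1,(0:F)).1 + c2*((0:F),(1:F)).1, c1*((1:F),(0:F)).2+c2*((0:F),(1:F)).2)
     (v1*(1,(0:F)).1 + v2*((0:F),(1:F)).1, v1*((1:F),(0:F)).2+v2*((0:F),(1:F)).2) := by simpa using ac
  have A2 : Cond ((0:F),(1:F)) (c1*(1,(0:F)).1 + c2*((0:F),(1:F)).1, c1*((1:F),(0:F)).2+c2*((0:F),(1:F)).2)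
     (v1*(1,(0:F)).1 + v2*((0:F),(1:F)).1, v1*((1:F),(0:F)).2+v2*((0:F),(1:F)).2) := by simpa using bc
  have A3 : Cond ((1:F),(0:F)) (d1*(1,(0:F)).1 + d2*((0:F),(1:F)).1, d1*((1:F),(0:F)).2+d2*((0:F),(1:F)).2)
     (v1*(1,(0:F)).1 + v2*((0:F),(1:F)).1, v1*((1:F),(0:F)).2+v2*((0:F),(1:F)).2) := by simpa using ad
  have A4 : Cond ((0:F),(1:F)) (d1*(1,(0:F)).1 + d2*((0:F),(1:F)).1, d1*((1:F),(0:F)).2+d2*((0:F),(1:F)).2)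
     (v1*(1,(0:F)).1 + v2*((0:F),(1:F)).1, v1*((1:F),(0:F)).2+v2*((0:F),(1:F)).2) := by simpa using bd
  obtain ⟨e1, e2, n1, n2, n3⟩ := cond_basis ab A1 A2
  obtain ⟨e3, e4, -, -, n4⟩ := cond_basis ab A3 A4
  have hcd : c1*d2-c2*d1 ≠ 0 := cd
  obtain ⟨hX, -⟩ := coordA h2 rfl e1 e2 n1 n2 n3
  obtain ⟨hne, s, pr, s1, s2, s3, s4⟩ := coordB h2 rfl e1 e2 rfl e3 e4 n1 n2 n3 n4 hcd
  have h22 : 2*v1*v2 ≠ 0 := mul_ne_zero (mul_ne_zero h2 n1) n2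
  have hP : 2*v1*v2*((v1+v2)/(2*v1*v2)) = v1+v2 := by field_simp
  generalize hPP : (v1+v2)/(2*v1*v2) = P at hP
  generalize c1*v2-c2*v1 = γ at *
  generalize d1*v2-d2*v1 = δ at *
  have hκ : (γ-δ)^2 = 2*v1*v2*(v1+v2)*(P-4) := by
    linear_combination (γ+δ+v1-v2)*s - 4*pr - (v1+v2)*hP
  refine ⟨P, γ-δ, ?_, ?_, n1, n2, hX, ?_, hP, ?_, ?_, hκ, s3, s4⟩
  · rintro rfl; apply hX; rw [← hP]; ring
  · intro h; rw [h, mul_zero] at hκ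
    exact pow_ne_zero 2 (sub_ne_zero.mpr hne) hκ
  · intro h; rw [h] at pr; simp at pr; tauto
  · apply mul_left_cancel₀ n2; linear_combination s1 - hP
  · apply mul_left_cancel₀ n1; linear_combination s2 - hP

theorem half {F : Type*} [Field F] (h2 : (2:F) ≠ 0) {v1 v2 w1 w2 P Q κ c1 c2 d1 d2 e1 e2 f1 f2 : F}
   (hP : P ≠ 0) (n1 : v1 ≠ 0) (n2 : v2 ≠ 0) (hX : v1+v2 ≠ 0) (hg : 1-2*(v1+v2) ≠ 0)
   (hPX : 2*v1*v2*P = v1+v2) 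
   (s1 : c1 + d1 = 2*(P-2)*v1 - 1) (s2 : c2 + d2 = 2*(P-2)*v2 - 1)
   (hκ : κ^2 = 2*v1*v2*(v1+v2)*(P-4)) (k1 : (c1-d1)*(v2*(v1+v2)) = κ*v1)
   (k2 : (c2-d2)*(v1*(v1+v2)) = -κ*v2)
   (t1 : e1 + f1 = 2*(Q-2)*w1 - 1) (t2 : e2 + f2 = 2*(Q-2)*w2 - 1)
   (h : Pr (c1,c2) (d1,d2) (e1,e2) (f1,f2) (w1-v1,w2-v2))
   (hω : v1*w2-v2*w1 ≠ 0) :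
   (v1*w2-v2*w1)*(P-4+(Q-4)+4) = (v1-v2)-(w1-w2) ∧
   ((w1-w2)+(P-4)*(v1*w2-v2*w1))*((v1+v2)*((P-4)^2+4*(P-4)-(Q-4)^2)-2*(P-4))
     = (P-4)*((v1+v2)*((P-4)-(Q-4)+4)-2)*(v1-v2) := by
  obtain ⟨g1, g2⟩ := h.G h2
  have hcu := h.ac.2.1
  have hdu := h.bc.2.1
  simp only [wd] at *
  obtain ⟨τ, hτ⟩ : ∃ τ, 2*τ*((c1 * (w2 - v2) - c2 * (w1 - v1)) * (d1 * (w2 - v2) - d2 * (w1 - v1)))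
    = -((c1 * d2 - c2 * d1) *
        (c1 * (w2 - v2) - c2 * (w1 - v1) - (d1 * (w2 - v2) - d2 * (w1 - v1)))) := by
    refine ⟨-((c1 * d2 - c2 * d1) *
        (c1 * (w2 - v2) - c2 * (w1 - v1) - (d1 * (w2 - v2) - d2 * (w1 - v1)))) / (2*((c1 * (w2 - v2) - c2 * (w1 - v1)) * (d1 * (w2 - v2) - d2 * (w1 - v1)))), ?_⟩
    field_simp
  have G1 : (c1 + d1 + e1 + f1 + 4 * (w1 - v1)) = 2*τ*(w1-v1) := by
    apply mul_right_cancel₀ (mul_ne_zero hcu hdu)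
    linear_combination g1 - (w1-v1)*hτ
  have G2 : (c2 + d2 + e2 + f2 + 4 * (w2 - v2)) = 2*τ*(w2-v2) := by
    apply mul_right_cancel₀ (mul_ne_zero hcu hdu)
    linear_combination g2 - (w2-v2)*hτ
  have u1 : (P-4+τ)*v1+(Q-τ)*w1 = 1 := by
    apply mul_left_cancel₀ h2; linear_combination G1 - s1 - t1
  have u2 : (P-4+τ)*v2+(Q-τ)*w2 = 1 := by
    apply mul_left_cancel₀ h2; linear_combination G2 - s2 - t2
  have r1 : (v1*w2-v2*w1)*(P-4+τ) = -(w1-w2) := by linear_combination w2*u1 - w1*u2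
  have r2 : (v1*w2-v2*w1)*(Q-τ) = v1-v2 := by linear_combination v1*u2 - v2*u1
  have r3 : (v1*w2-v2*w1)*(P-4+(Q-4)+4) = (v1-v2)-(w1-w2) := by linear_combination r1+r2
  refine ⟨r3, ?_⟩
  -- scalars
  obtain ⟨ω, hω'⟩ : ∃ ω, ω = v1*w2-v2*w1 := ⟨_, rfl⟩
  obtain ⟨Nu, hNu⟩ : ∃ Nu, v1*v2*(v1+v2)*Nu = v1^2*(w2-v2) + v2^2*(w1-v1) :=
    ⟨(v1^2*(w2-v2) + v2^2*(w1-v1))/(v1*v2*(v1+v2)), by field_simp⟩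
  have NU : (v1+v2)*(v1-v2)*Nu = ω*((v1+v2)*(P-Q+4)-2) := by
    apply mul_left_cancel₀ (mul_ne_zero n1 n2)
    rw [← hω'] at r3
    have r4 : (v1+v2)*(ω*((v1+v2)*(P-Q+4)-2)) = (v1+v2)*(-(v1+v2)*((v1-v2)-(w1-w2)) + 2*ω*(v1+v2)*P - 2*ω) := by
      linear_combination (-(v1+v2)^2)*r3
    have r5 : (v1+v2)*(v1*v2*((v1+v2)*(v1-v2)*Nu)) = (v1+v2)*(v1*v2*(ω*((v1+v2)*(P-Q+4)-2))) := by
      subst hω'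
      linear_combination (v1+v2)*(v1-v2)*hNu - v1*v2*r4 - (v1+v2)^2*(v1*w2-v2*w1)*hPX
    exact mul_left_cancel₀ hX r5
  -- sum and difference wedge u
  have M : (c1+d1)*(w2-v2) - (c2+d2)*(w1-v1) = ω*(P-Q) := by
    subst hω'
    linear_combination (w2-v2)*s1 - (w1-v1)*s2 + r3
  have Dif : (c1-d1)*(w2-v2) - (c2-d2)*(w1-v1) = κ*Nu := by
    apply mul_left_cancel₀ (mul_ne_zero (mul_ne_zero n1 n2) hX)
    linear_combination v1*(w2-v2)*k1 - v2*(w1-v1)*k2 - κ*hNu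
  have CD : (v1+v2)*((c1-d1)*(c2+d2) - (c2-d2)*(c1+d1)) = 2*κ*(1-2*(v1+v2)) := by
    apply mul_left_cancel₀ (mul_ne_zero n1 n2)
    rw [s1, s2]
    linear_combination v1*(2*(P-2)*v2-1)*k1 - v2*(2*(P-2)*v1-1)*k2 + κ*(v1+v2)*hPX
  have T0 : τ*((ω*(P-Q))^2 - (κ*Nu)^2) = -(((c1-d1)*(c2+d2) - (c2-d2)*(c1+d1))*(κ*Nu)) := by
    apply mul_left_cancel₀ h2
    rw [← M, ← Dif]
    linear_combination 4*hτ
  have T1 : (v1+v2)*τ*((ω*(P-Q))^2 - (κ*Nu)^2) = -(2*κ^2*(1-2*(v1+v2))*Nu) := by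
    linear_combination (v1+v2)*T0 - κ*Nu*CD
  have HP : (v1-v2)^2*P = (v1+v2)*((v1+v2)*P-2) := by linear_combination (-2)*hPX
  have KP : κ^2*P = (v1+v2)^2*(P-4) := by linear_combination P*hκ + (v1+v2)*(P-4)*hPX
  have T2 : (v1+v2)^3*ω*((τ*ω)*((v1-v2)^2*P*(P-Q)^2 - (P-4)*((v1+v2)*(P-Q+4)-2)^2)
      + 2*(P-4)*(1-2*(v1+v2))*(v1-v2)*((v1+v2)*(P-Q+4)-2)) = 0 := by
    linear_combination (v1+v2)^2*(v1-v2)^2*P*T1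
      + ((v1+v2)*τ*(v1+v2)^2*(v1-v2)^2*Nu^2 - 2*(1-2*(v1+v2))*(v1+v2)^2*(v1-v2)^2*Nu)*KP
      + ((v1+v2)^3*τ*(P-4)*((v1+v2)*(v1-v2)*Nu + ω*((v1+v2)*(P-Q+4)-2)) - 2*(v1+v2)^3*(P-4)*(1-2*(v1+v2))*(v1-v2))*NU
  rw [← hω'] at hω r1 r2 r3
  have T3 := (mul_eq_zero.mp T2).resolve_left (mul_ne_zero (pow_ne_zero 3 hX) hω)
  have hτω : τ*ω = -(w1-w2) - (P-4)*ω := by linear_combination r1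
  rw [← hω']
  rw [hτω, HP] at T3
  apply mul_left_cancel₀ (mul_ne_zero h2 hg)
  linear_combination -T3
end Kak

namespace Kak

theorem three_coord {F : Type*} [Field F] (h2 : (2:F) ≠ 0)
    {v1 v2 w1 w2 c1 c2 d1 d2 e1 e2 f1 f2 : F}
    (h : Pr ((1:F),(0:F)) (0,1) (c1,c2) (d1,d2) (v1,v2))
    (h' : Pr ((1:F),(0:F)) (0,1) (e1,e2) (f1,f2) (w1,w2))
    (h'' : Pr (c1,c2) (d1,d2) (e1,e2) (f1,f2) (w1-v1,w2-v2))
    (hω : v1*w2-v2*w1 ≠ 0) (hdv : v1 - v2 ≠ 0) (hdw : w1-w2 ≠ 0) : False := by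
  obtain ⟨P, κ, hP, hp, n1, n2, hX, hg, hPX, s1, s2, hκ, k1, k2⟩ := std_pair h2 h
  obtain ⟨Q, σ, hQ, hr, m1, m2, hY, hg', hQY, t1, t2, hσ, l1, l2⟩ := std_pair h2 h'
  obtain ⟨r3, e3⟩ := half h2 hP n1 n2 hX hg hPX s1 s2 hκ k1 k2 t1 t2 h'' hω
  have h3 : Pr (e1,e2) (f1,f2) (c1,c2) (d1,d2) (v1-w1,v2-w2) := by
    have := h''.symm; simpa using this
  have hω' : w1*v2-w2*v1 ≠ 0 := by
    intro h; apply hω; linear_combination -h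
  obtain ⟨-, e3'⟩ := half h2 hQ m1 m2 hY hg' hQY t1 t2 hσ l1 l2 s1 s2 h3 hω'
  refine fin_scalar h2 (v1+v2) (w1+w2) (P-4) (Q-4) (v1-v2) (w1-w2) (v1*w2-v2*w1) ?_ r3 e3 ?_ ?_ ?_ hX hY hp hr
    (by simpa using hP) (by simpa using hQ) hdv hdw hω
  · ring
  · linear_combination e3'
  · linear_combination (-2)*hPX
  · linear_combination (-2)*hQY

theorem cond_lc {F : Type*} [Field F] {a b : F × F} (h : wd a b ≠ 0) {v1 v2 c1 c2 d1 d2 : F}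
    (hc : Cond (c1*a.1 + c2*b.1, c1*a.2+c2*b.2) (d1*a.1 + d2*b.1, d1*a.2+d2*b.2)
      (v1*a.1 + v2*b.1, v1*a.2+v2*b.2)) :
    Cond (c1,c2) (d1,d2) (v1,v2) := by
  obtain ⟨h1, h2, h3⟩ := hc
  simp only [wd, Cond] at *
  refine ⟨?_, ?_, ?_⟩
  · apply mul_left_cancel₀ (pow_ne_zero 2 h); linear_combination h1
  · intro hh; apply h2; linear_combination (a.1*b.2-a.2*b.1)*hh
  · intro hh; apply h3; linear_combination (a.1*b.2-a.2*b.1)*hh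

theorem pr_lc {F : Type*} [Field F] {a b : F × F} (h : wd a b ≠ 0) {v1 v2 c1 c2 d1 d2 e1 e2 f1 f2: F}
    (hc : Pr (c1*a.1 + c2*b.1, c1*a.2+c2*b.2) (d1*a.1 + d2*b.1, d1*a.2+d2*b.2)
       (e1*a.1 + e2*b.1, e1*a.2+e2*b.2) (f1*a.1 + f2*b.1, f1*a.2+f2*b.2)
      (v1*a.1 + v2*b.1, v1*a.2+v2*b.2)) :
    Pr (c1,c2) (d1,d2) (e1,e2) (f1,f2) (v1,v2) := by
  obtain ⟨ac, ad, bc, bd, ab, cd⟩ := hc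
  refine ⟨cond_lc h ac, cond_lc h ad, cond_lc h bc, cond_lc h bd, ?_, ?_⟩
  · intro hh; apply ab; simp only [wd] at *; linear_combination (a.1*b.2-a.2*b.1)*hh
  · intro hh; apply cd; simp only [wd] at *; linear_combination (a.1*b.2-a.2*b.1)*hh

theorem three0 {F : Type*} [Field F] (h2 : (2:F) ≠ 0) {a b c d e f v w : F × F}
    (h : Pr a b c d v) (h' : Pr a b e f w) (h'' : Pr c d e f (w-v))
    (hω : wd v w ≠ 0) (hv : wd (a+b) v ≠ 0) (hw : wd (a+b) w ≠ 0) : False := by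
  have ab := h.ab
  obtain ⟨v1, v2, rfl⟩ := basis ab v
  obtain ⟨w1, w2, rfl⟩ := basis ab w
  obtain ⟨c1, c2, rfl⟩ := basis ab c
  obtain ⟨d1, d2, rfl⟩ := basis ab d
  obtain ⟨e1, e2, rfl⟩ := basis ab e
  obtain ⟨f1, f2, rfl⟩ := basis ab f
  have ha : a = ((1:F)*a.1+0*b.1, 1*a.2+0*b.2) := by ext <;> simp
  have hb : b = ((0:F)*a.1+1*b.1, 0*a.2+1*b.2) := by ext <;> simp
  have A1 : Pr ((1:F),(0:F)) (0,1) (c1,c2) (d1,d2) (v1,v2) := by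
    apply pr_lc ab; rw [← ha, ← hb]; exact h
  have A2 : Pr ((1:F),(0:F)) (0,1) (e1,e2) (f1,f2) (w1,w2) := by
    apply pr_lc ab; rw [← ha, ← hb]; exact h'
  have A3 : Pr (c1,c2) (d1,d2) (e1,e2) (f1,f2) (w1-v1,w2-v2) := by
    apply pr_lc ab
    convert h'' using 1
    ext <;> simp <;> ring
  refine three_coord h2 A1 A2 A3 ?_ ?_ ?_
  · intro hh; apply hω; simp only [wd] at *; linear_combination (a.1*b.2-a.2*b.1)*hh
  · intro hh; apply hv; simp only [wd, Prod.fst_add, Prod.snd_add] at *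
    linear_combination (-(a.1*b.2-a.2*b.1))*hh
  · intro hh; apply hw; simp only [wd, Prod.fst_add, Prod.snd_add] at *
    linear_combination (-(a.1*b.2-a.2*b.1))*hh

theorem wd_zero_of {F : Type*} [Field F] {a b v w : F × F} (ab : wd a b ≠ 0) (hω : wd v w ≠ 0)
   (hv : wd (a+b) v = 0) (hw : wd (a+b) w = 0) : False := by
  have x1 : (a+b).1 = 0 := by
    apply mul_left_cancel₀ hω
    simp only [wd, Prod.fst_add, Prod.snd_add] at *
    linear_combination v.1 * hw - w.1*hv
  have x2 : (a+b).2 = 0 := by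
    apply mul_left_cancel₀ hω
    simp only [wd, Prod.fst_add, Prod.snd_add] at *
    linear_combination v.2 * hw - w.2*hv
  apply ab
  simp only [wd, Prod.fst_add, Prod.snd_add] at *
  linear_combination b.2*x1 - b.1 * x2

theorem three {F : Type*} [Field F] (h2 : (2:F) ≠ 0) {a b c d e f v w : F × F}
    (h : Pr a b c d v) (h' : Pr a b e f w) (h'' : Pr c d e f (w-v))
    (hω : wd v w ≠ 0) : False := by
  have S1 := h.sum h2
  have S2 := h'.sum h2
  have S3 := h''.sum h2
  by_cases hv : wd (a+b) v = 0
  · -- rebase at W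
    have k1 : wd (a+b) w ≠ 0 := fun hw => wd_zero_of h.ab hω hv hw
    have k2 : wd (c+d) (w-v) ≠ 0 := fun hw => by
      refine wd_zero_of (v := v) (w := w) h.cd hω ?_ ?_
      · rw [hv] at S1; linear_combination S1
      · rw [hv] at S1; simp only [wd, Prod.fst_add, Prod.snd_add, Prod.fst_sub, Prod.snd_sub] at *
        linear_combination hw + S1
    refine three0 h2 (v := -w) (w := -(w-v)) h'.symm h''.symm ?_ ?_ ?_ ?_
    · convert h using 1; abel
    · intro hh; apply hω; simp only [wd, Prod.fst_neg, Prod.snd_neg, Prod.fst_sub, Prod.snd_sub] at *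
      linear_combination hh
    · intro hh; apply k1; rw [S2]
      simp only [wd, Prod.fst_neg, Prod.snd_neg, Prod.fst_sub, Prod.snd_sub, Prod.fst_add, Prod.snd_add] at *
      linear_combination hh
    · intro hh; apply k2; rw [S3]
      simp only [wd, Prod.fst_neg, Prod.snd_neg, Prod.fst_sub, Prod.snd_sub, Prod.fst_add, Prod.snd_add] at *
      linear_combination hh
  · by_cases hw : wd (a+b) w = 0
    · have k2 : wd (c+d) (w-v) ≠ 0 := fun hh => by
        refine wd_zero_of (v := v) (w := w) h'.cd hω ?_ ?_
        · rw [hw] at S2; rw [hh] at S3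
          simp only [wd, Prod.fst_add, Prod.snd_add, Prod.fst_sub, Prod.snd_sub] at *
          linear_combination S2 - S3
        · rw [hw] at S2; linear_combination S2
      refine three0 h2 (v := -v) (w := (w-v)) h.symm h'' ?_ ?_ ?_ k2
      · convert h' using 1; abel
      · intro hh; apply hω; simp only [wd, Prod.fst_neg, Prod.snd_neg, Prod.fst_sub, Prod.snd_sub] at *
        linear_combination -hh
      · intro hh; apply hv; rw [S1]
        simp only [wd, Prod.fst_neg, Prod.snd_neg, Prod.fst_sub, Prod.snd_sub, Prod.fst_add, Prod.snd_add] at *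
        linear_combination hh
    · exact three0 h2 h h' h'' hω hv hw

/-- in all cases the third line through `U` contains `V` -/
theorem three_coll {F : Type*} [Field F] (h2 : (2:F) ≠ 0) {a b c d e f v w : F × F}
    (h : Pr a b c d v) (h' : Pr a b e f w) (h'' : Pr c d e f (w-v)) : wd (a+b) v = 0 := by
  have hω : wd v w = 0 := by
    by_contra hω; exact three h2 h h' h'' hω
  have S1 := h.sum h2
  have S2 := h'.sum h2
  have S3 := h''.sum h2
  -- v, w, w - v nonzero and parallel
  have hv : v ≠ 0 := by
    rintro rfl; exact h.ac.2.1 (by simp [wd])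
  have hwv : w - v ≠ 0 := by
    intro hh; rw [hh] at h''; exact h''.ac.2.1 (by simp [wd])
  have hw : w ≠ 0 := by
    rintro rfl; exact h'.ac.2.1 (by simp [wd])
  obtain ⟨t, rfl⟩ : ∃ t : F, w = t • v := by
    by_cases h1 : v.1 = 0
    · have h22 : v.2 ≠ 0 := fun hh => hv (Prod.ext h1 hh)
      refine ⟨w.2/v.2, ?_⟩
      ext
      · simp [h1]; simp [wd, h1] at hω; tauto
      · simp; field_simp
    · refine ⟨w.1/v.1, ?_⟩
      ext
      · simp; field_simp
      · simp; field_simp; simp only [wd] at hω; linear_combination hω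
  have t0 : t ≠ 0 := by rintro rfl; simp at hw
  have t1 : t - 1 ≠ 0 := by
    intro hh; apply hwv
    have : t = 1 := by linear_combination hh
    simp [this]
  simp only [wd, Prod.fst_add, Prod.snd_add, Prod.fst_sub, Prod.snd_sub, Prod.smul_fst, Prod.smul_snd, smul_eq_mul] at *
  have S2' : (a.1 + b.1) * (v.2) - (a.2 + b.2) * (v.1) = -((e.1 + f.1) * (v.2) - (e.2 + f.2) * (v.1)) := by
    apply mul_left_cancel₀ t0; linear_combination S2
  have S3' : (c.1 + d.1) * (v.2) - (c.2 + d.2) * (v.1) = -((e.1 + f.1) * (v.2) - (e.2 + f.2) * (v.1)) := by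
    apply mul_left_cancel₀ t1; linear_combination S3
  apply mul_left_cancel₀ h2
  linear_combination S1 + S2' - S3'

/-- three good lines at one point, two at another -/
theorem no_three_two {F : Type*} [Field F] (h2 : (2:F) ≠ 0) {a b c d e v : F × F}
    (h : Pr a b d e v) (h' : Pr a c d e v) (h'' : Pr b c d e v) : False := by
  have S1 := h.sum h2
  have S2 := h'.sum h2
  have S3 := h''.sum h2
  apply diff_ne h2 h.ab h.ac h.bc
  simp only [wd, Prod.fst_add, Prod.snd_add] at *
  linear_combination S2 - S3
end Kak

namespace Kak
open Finset

section
variable {F : Type*} [Field F]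

def D : Option F → F × F
  | none => (0, 1)
  | some m => (1, m)

theorem W_ne {i k : Option F} (h : i ≠ k) : wd (D i) (D k) ≠ 0 := by
  cases i <;> cases k <;> simp [D, wd] at *
  rw [sub_eq_zero]; exact fun hh => h hh.symm

theorem W_antisymm (i k : Option F) : wd (D k) (D i) = - wd (D i) (D k) := by
  simp [wd]; ring

def el (c : Option F → F) (k : Option F) (X : F × F) : F := wd (D k) X - c k

theorem el_param (c : Option F → F) (i k : Option F) (X : F × F) (s : F) :
    el c k (X + s • D i) = el c k X - s * wd (D i) (D k) := by
  simp [el, wd]; ring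

theorem D_ne (i : Option F) : D i ≠ 0 := by
  cases i <;> simp [D, Prod.ext_iff]

theorem param {c : Option F → F} {i : Option F} {X Y : F × F} (hX : el c i X = 0) (hY : el c i Y = 0) :
    ∃ s : F, Y = X + s • D i := by
  cases i with
  | none =>
    refine ⟨Y.2 - X.2, ?_⟩
    simp [el, wd, D] at *
    ext <;> simp
    linear_combination hX - hY
  | some m =>
    refine ⟨Y.1 - X.1, ?_⟩
    simp [el, wd, D] at *
    ext <;> simp
    linear_combination hY - hX

theorem param_inj {i : Option F} {X : F × F} {s t : F} (h : X + s • D i = X + t • D i) : s = t := by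
  have := add_left_cancel h
  exact smul_left_injective F (D_ne i) this

theorem param_eq {i : Option F} {X : F × F} {s : F} (h : X + s • D i = X) : s = 0 := by
  apply param_inj (i := i) (X := X); simpa using h

theorem inter {i j : Option F} (c : Option F → F) (h : i ≠ j) : ∃ X, el c i X = 0 ∧ el c j X = 0 := by
  have hW := W_ne h
  refine ⟨((c i * (D j).1 - c j * (D i).1)/wd (D i) (D j), (c i * (D j).2 - c j * (D i).2)/wd (D i) (D j)), ?_, ?_⟩
  · simp only [el]
    rw [sub_eq_zero]
    apply mul_right_cancel₀ hW
    simp only [wd] at *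
    field_simp
    ring
  · simp only [el]
    rw [sub_eq_zero]
    apply mul_right_cancel₀ hW
    generalize hh : wd (D i) (D j) = w at *
    simp only [wd] at *
    field_simp
    rw [← hh]
    ring

theorem inter_unique {i j : Option F} {c : Option F → F} (h : i ≠ j) {X Y : F × F}
    (h1 : el c i X = 0) (h2 : el c j X = 0) (h3 : el c i Y = 0) (h4 : el c j Y = 0) : X = Y := by
  obtain ⟨s, rfl⟩ := param h1 h3
  rw [el_param, h2] at h4
  have : s = 0 := by
    have := (mul_eq_zero.mp (by linear_combination -h4 : s * wd (D i) (D j) = 0))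
    exact this.resolve_right (W_ne h)
  simp [this]
end

section
variable {F : Type*} [Field F] [Fintype F] [DecidableEq F]

def mm (c : Option F → F) (X : F × F) : ℕ := #{k | el c k X = 0}

theorem prod_nonzero : ∏ x ∈ (univ.erase (0:F)), x = -1 := by
  have : (univ.erase (0:F)) = (univ : Finset Fˣ).map (⟨fun u : Fˣ => (u : F), Units.val_injective⟩ : Fˣ ↪ F) := by
    ext x; simp
    constructor
    · intro hx; exact ⟨Units.mk0 x hx, rfl⟩
    · rintro ⟨u, rfl⟩; exact u.ne_zero
  rw [this, prod_map]
  have h := congrArg (fun u : Fˣ => (u : F)) (FiniteField.prod_univ_units_id_eq_neg_one (K := F))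
  simpa using h

theorem W_prod (hodd : Odd (Fintype.card F)) (i : Option F) : ∏ k ∈ univ.erase i, wd (D i) (D k) = -1 := by
  cases i with
  | none =>
    have : (univ : Finset (Option F)).erase none = univ.map Function.Embedding.some := by
      ext x; cases x <;> simp
    rw [this, prod_map]
    simp [D, wd, hodd.neg_one_pow]
  | some m =>
    have : (univ : Finset (Option F)).erase (some m) = insert none ((univ.erase m).map Function.Embedding.some) := by
      ext x; cases x <;> simp
    rw [this, prod_insert (by simp), prod_map]
    simp only [D, wd, Function.Embedding.some_apply]
    rw [← prod_nonzero (F := F)]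
    have : (univ.erase (0:F)) = (univ.erase m).map ⟨fun x => x - m, sub_left_injective⟩ := by
      ext x; simp [sub_eq_iff_eq_add]
    rw [this, prod_map]
    simp [mul_comm]

/-- the Segre product -/
def Q (c : Option F → F) (X : F × F) : F := ∏ k with el c k X ≠ 0, el c k X

def nz (x : F) : F := if x = 0 then 1 else x

theorem prod_pow_ite (u : F) : ∏ x ∈ univ.erase (0:F), x ^ (if x = u then 1 else 0) = nz u := by
  simp only [pow_ite, pow_one, pow_zero]
  rw [prod_ite_eq']
  simp [nz]

theorem segre0 (hodd : Odd (Fintype.card F)) (c : Option F → F) {i : Option F} {X : F × F} (hX : el c i X = 0) :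
    Q c X * ∏ k ∈ univ.erase i with el c k X = 0, wd (D i) (D k) =
      - ∏ x ∈ univ.erase (0:F), x ^ (mm c (X + x • D i) - 1) := by
  classical
  let s : Option F → F := fun k => el c k X / wd (D i) (D k)
  have hs : ∀ k ∈ univ.erase i, el c k X = s k * wd (D i) (D k) := by
    intro k hk
    have := W_ne (Finset.ne_of_mem_erase hk).symm
    simp only [s]; field_simp
  have hQ : Q c X = ∏ k ∈ univ.erase i with el c k X ≠ 0, el c k X := by
    unfold Q
    congr 1
    ext k; simp
    rintro h rfl; exact h hX
  have hQ2 : Q c X = (∏ k ∈ univ.erase i with el c k X ≠ 0, s k) * ∏ k ∈ univ.erase i with el c k X ≠ 0, wd (D i) (D k) := by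
    rw [hQ, ← prod_mul_distrib]
    apply prod_congr rfl
    intro k hk; exact hs k (mem_filter.mp hk).1
  have hW : (∏ k ∈ univ.erase i with el c k X = 0, wd (D i) (D k)) * (∏ k ∈ univ.erase i with el c k X ≠ 0, wd (D i) (D k)) = -1 := by
    rw [prod_filter_mul_prod_filter_not, W_prod hodd]
  have hf : (∏ k ∈ univ.erase i with el c k X ≠ 0, s k) = ∏ x ∈ univ.erase (0:F), x ^ (mm c (X + x • D i) - 1) := by
    rw [← prod_fiberwise_of_maps_to (g := s) (t := univ.erase (0:F))]
    · apply prod_congr rfl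
      intro x hx
      rw [prod_congr rfl (g := fun _ => x)]
      · rw [prod_const]
        congr 1
        have : ({k | el c k (X + x • D i) = 0} : Finset (Option F)) = insert i {k ∈ {k ∈ univ.erase i | el c k X ≠ 0} | s k = x} := by
          ext k
          simp only [mem_filter, mem_univ, true_and, mem_insert, mem_erase, and_true]
          rw [el_param]
          by_cases hk : k = i
          · subst hk; simp [hX, wd]; right; ring
          · have hkk := W_ne (Ne.symm hk)
            have := hs k (by simp [hk])
            have hx0 : x ≠ 0 := by simpa using hx
            simp only [hk, false_or]
            rw [this]
            constructor
            · intro h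
              have : s k = x := by
                apply mul_right_cancel₀ hkk; linear_combination h
              rw [this]; exact ⟨⟨hk, mul_ne_zero hx0 hkk⟩, rfl⟩
            · rintro ⟨-, h⟩; rw [h]; ring
        unfold mm
        rw [this, card_insert_of_notMem (by simp)]
        simp
      · intro k hk; exact (mem_filter.mp hk).2
    · intro k hk
      simp only [mem_filter] at hk
      have := W_ne (Finset.ne_of_mem_erase hk.1).symm
      simp [s, hk.2, this]
  rw [← hf, hQ2]
  linear_combination (∏ k ∈ univ.erase i with el c k X ≠ 0, s k) * hW

structure Good (c : Option F → F) (i : Option F) (U T : F × F) : Prop where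
  hU : el c i U = 0
  hT : el c i T = 0
  mU : mm c U = 3
  mT : mm c T = 1
  m2 : ∀ X, el c i X = 0 → X ≠ U → X ≠ T → mm c X = 2

def Nuc (c : Option F → F) (i : Option F) : Prop := ∀ X, el c i X = 0 → mm c X = 2

theorem el_on {c : Option F → F} {i : Option F} {X : F × F} (hX : el c i X = 0) (x : F) :
    el c i (X + x • D i) = 0 := by
  rw [el_param, hX]; simp [wd]; right; ring

theorem segre_nuc (hodd : Odd (Fintype.card F)) {c : Option F → F} {i : Option F} {X : F × F} (hX : el c i X = 0)
    (h : Nuc c i) : Q c X * ∏ k ∈ univ.erase i with el c k X = 0, wd (D i) (D k) = 1 := by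
  rw [segre0 hodd c hX, prod_congr rfl (g := fun x => x), prod_nonzero, neg_neg]
  intro x _
  rw [h _ (el_on hX x)]; simp

theorem segre_good (hodd : Odd (Fintype.card F)) {c : Option F → F} {i : Option F} {X : F × F} (hX : el c i X = 0)
    {u t : F} (h : Good c i (X + u • D i) (X + t • D i)) :
    Q c X * (∏ k ∈ univ.erase i with el c k X = 0, wd (D i) (D k)) * nz t = nz u := by
  rw [segre0 hodd c hX]
  have hut : u ≠ t := by
    rintro rfl; have := h.mU; rw [h.mT] at this; omega
  have : (∏ x ∈ univ.erase (0:F), x ^ (mm c (X + x • D i) - 1)) * nz t = (∏ x ∈ univ.erase (0:F), x) * nz u := by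
    rw [← prod_pow_ite t, ← prod_pow_ite u, ← prod_mul_distrib, ← prod_mul_distrib]
    apply prod_congr rfl
    intro x _
    by_cases h1 : x = t
    · subst h1
      simp [h.mT, hut.symm]
    · by_cases h2 : x = u
      · subst h2
        simp [h.mU, h1, pow_two]
      · rw [h.m2 _ (el_on hX x) (fun hh => h2 (param_inj hh)) (fun hh => h1 (param_inj hh))]
        simp [h1, h2]
  rw [neg_mul, this, prod_nonzero]; ring
end
end Kak

namespace Kak
open Finset

section
variable {F : Type*} [Field F] [Fintype F] [DecidableEq F]

theorem thr2 {c : Option F → F} {i j : Option F} {X : F × F} (hij : i ≠ j)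
    (hi : el c i X = 0) (hj : el c j X = 0) (hm : mm c X = 2) :
    ({k | el c k X = 0} : Finset (Option F)) = {i, j} := by
  symm
  apply eq_of_subset_of_card_le
  · intro k; simp; rintro (rfl | rfl) <;> assumption
  · rw [card_pair hij]; exact hm.le

theorem thr3 {c : Option F → F} {i j l : Option F} {X : F × F} (hij : i ≠ j) (hil : i ≠ l) (hjl : j ≠ l)
    (hi : el c i X = 0) (hj : el c j X = 0) (hl : el c l X = 0) (hm : mm c X = 3) :
    ({k | el c k X = 0} : Finset (Option F)) = {i, j, l} := by
  symm
  apply eq_of_subset_of_card_le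
  · intro k; simp; rintro (rfl | rfl | rfl) <;> assumption
  · rw [card_eq_three.mpr ⟨i, j, l, hij, hil, hjl, rfl⟩]; exact hm.le

theorem prod2 {c : Option F → F} {i j : Option F} {X : F × F} (hij : i ≠ j)
    (hi : el c i X = 0) (hj : el c j X = 0) (hm : mm c X = 2) :
    ∏ k ∈ univ.erase i with el c k X = 0, wd (D i) (D k) = wd (D i) (D j) := by
  have : ({k ∈ univ.erase i | el c k X = 0} : Finset (Option F)) = {j} := by
    rw [filter_erase, thr2 hij hi hj hm]; ext k; simp; grind
  rw [this, prod_singleton]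

theorem prod3 {c : Option F → F} {i j l : Option F} {X : F × F} (hij : i ≠ j) (hil : i ≠ l) (hjl : j ≠ l)
    (hi : el c i X = 0) (hj : el c j X = 0) (hl : el c l X = 0) (hm : mm c X = 3) :
    ∏ k ∈ univ.erase i with el c k X = 0, wd (D i) (D k) = wd (D i) (D j) * wd (D i) (D l) := by
  have : ({k ∈ univ.erase i | el c k X = 0} : Finset (Option F)) = {j, l} := by
    rw [filter_erase, thr3 hij hil hjl hi hj hl hm]; ext k; simp; grind
  rw [this, prod_pair hjl]

theorem mm_ge2 {c : Option F → F} {i j : Option F} {X : F × F} (hij : i ≠ j)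
    (hi : el c i X = 0) (hj : el c j X = 0) : 2 ≤ mm c X := by
  rw [← card_pair hij]; apply card_le_card
  intro k; simp; rintro (rfl | rfl) <;> assumption

theorem two_nuc (h2 : (2:F) ≠ 0) (hodd : Odd (Fintype.card F)) {c : Option F → F} {i j : Option F} (hij : i ≠ j)
    (hi : Nuc c i) (hj : Nuc c j) : False := by
  obtain ⟨X, h3, h4⟩ := inter c hij
  have e1 := segre_nuc hodd h3 hi
  have e2 := segre_nuc hodd h4 hj
  rw [prod2 hij h3 h4 (hi _ h3)] at e1
  rw [prod2 hij.symm h4 h3 (hi _ h3), W_antisymm] at e2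
  apply h2; linear_combination -e1 - e2

theorem good_params {c : Option F → F} {i : Option F} {U T X : F × F} (h : Good c i U T) (hX : el c i X = 0) :
    ∃ u t : F, U = X + u • D i ∧ T = X + t • D i ∧ u ≠ t := by
  obtain ⟨u, hu⟩ := param hX h.hU
  obtain ⟨t, ht⟩ := param hX h.hT
  refine ⟨u, t, hu, ht, ?_⟩
  rintro rfl
  have := h.mU; rw [hu, ← ht, h.mT] at this; omega

theorem nuc_good (h2 : (2:F) ≠ 0) (hodd : Odd (Fintype.card F)) {c : Option F → F} {i M : Option F} {U T : F × F}
    (hM : Nuc c M) (h : Good c i U T) : el c M U + el c M T = 0 := by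
  have hij : M ≠ i := by
    rintro rfl; have := hM _ h.hU; rw [h.mU] at this; omega
  obtain ⟨X, h3, h4⟩ := inter c hij
  obtain ⟨u, t, rfl, rfl, hut⟩ := good_params h h4
  have e1 := segre_nuc hodd h3 hM
  have e2 := segre_good hodd h4 h
  rw [prod2 hij h3 h4 (hM _ h3)] at e1
  rw [prod2 hij.symm h4 h3 (hM _ h3), W_antisymm] at e2
  have hu : u ≠ 0 := by
    rintro rfl; have := h.mU; simp [hM _ h3] at this
  have ht : t ≠ 0 := by
    rintro rfl; have := h.mT; simp [hM _ h3] at this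
  simp only [nz, hu, ht, if_false] at e2
  rw [el_param, el_param, h3]
  have : u = -t := by linear_combination -e2 - t * e1
  rw [this]; ring

theorem good_cond (hodd : Odd (Fintype.card F)) {c : Option F → F} {i j : Option F} {U T U' T' : F × F}
    (h : Good c i U T) (h' : Good c j U' T') (hU : U ≠ U') : Cond (T - U) (T' - U') (U' - U) := by
  by_cases hij : i = j
  · subst hij
    have := h.m2 U' h'.hU (Ne.symm hU) (by rintro rfl; have := h.mT; rw [h'.mU] at this; omega)
    rw [h'.mU] at this; omega
  obtain ⟨X, h3, h4⟩ := inter c hij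
  have hge := mm_ge2 hij h3 h4
  have hXT : X ≠ T := by rintro rfl; rw [h.mT] at hge; omega
  have hXT' : X ≠ T' := by rintro rfl; rw [h'.mT] at hge; omega
  have hXU : X ≠ U := by
    intro hh
    have h5 : mm c X = 3 := by rw [hh]; exact h.mU
    by_cases h6 : X = U'
    · exact hU (hh.symm.trans h6)
    · have := h'.m2 X h4 h6 hXT'; omega
  have hm := h.m2 X h3 hXU hXT
  have hXU' : X ≠ U' := by
    intro hh; have := h'.mU; rw [← hh] at this; omega
  obtain ⟨u, t, rfl, rfl, hut⟩ := good_params h h3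
  obtain ⟨u', t', rfl, rfl, hut'⟩ := good_params h' h4
  have hu : u ≠ 0 := by rintro rfl; simp at hXU
  have ht : t ≠ 0 := by rintro rfl; simp at hXT
  have hu' : u' ≠ 0 := by rintro rfl; simp at hXU'
  have ht' : t' ≠ 0 := by rintro rfl; simp at hXT'
  have e1 := segre_good hodd h3 h
  have e2 := segre_good hodd h4 h'
  rw [prod2 hij h3 h4 hm] at e1
  rw [prod2 (Ne.symm hij) h4 h3 hm, W_antisymm] at e2
  simp only [nz, hu, ht, hu', ht', if_false] at e1 e2
  have key : u * t' + u' * t = 0 := by linear_combination (-t')*e1 - t * e2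
  have hW := W_ne hij
  refine ⟨?_, ?_, ?_⟩
  · simp only [wd, Prod.fst_add, Prod.snd_add, Prod.fst_sub, Prod.snd_sub, Prod.smul_fst, Prod.smul_snd, smul_eq_mul] at *
    linear_combination (t-u)*(t'-u')*((D i).1 * (D j).2 - (D i).2 * (D j).1)^2*key
  · have : wd (X + t • D i - (X + u • D i)) (X + u' • D j - (X + u • D i)) = (t-u)*u'*wd (D i) (D j) := by
      simp only [wd, Prod.fst_add, Prod.snd_add, Prod.fst_sub, Prod.snd_sub, Prod.smul_fst, Prod.smul_snd, smul_eq_mul]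
      ring
    rw [this]; exact mul_ne_zero (mul_ne_zero (sub_ne_zero.mpr hut.symm) hu') hW
  · have : wd (X + t' • D j - (X + u' • D j)) (X + u' • D j - (X + u • D i)) = (t'-u')*u*wd (D i) (D j) := by
      simp only [wd, Prod.fst_add, Prod.snd_add, Prod.fst_sub, Prod.snd_sub, Prod.smul_fst, Prod.smul_snd, smul_eq_mul]
      ring
    rw [this]; exact mul_ne_zero (mul_ne_zero (sub_ne_zero.mpr hut'.symm) hu) hW

theorem good_wd {c : Option F → F} {i j : Option F} {U T U' T' : F × F} (hij : i ≠ j)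
    (h : Good c i U T) (h' : Good c j U' T') : wd (T - U) (T' - U') ≠ 0 := by
  obtain ⟨u, t, h1, rfl, hut⟩ := good_params h h.hU
  obtain ⟨u', t', h1', rfl, hut'⟩ := good_params h' h'.hU
  have : u = 0 := param_eq h1.symm
  subst this
  have : u' = 0 := param_eq h1'.symm
  subst this
  have : wd (U + t • D i - U) (U' + t' • D j - U') = t * t' * wd (D i) (D j) := by
    simp [wd]; ring
  rw [this]; exact mul_ne_zero (mul_ne_zero hut.symm hut'.symm) (W_ne hij)

theorem good_third (hodd : Odd (Fintype.card F)) {c : Option F → F} {i j l : Option F} {U T T' : F × F}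
    (hij : i ≠ j) (hil : i ≠ l) (hjl : j ≠ l)
    (h : Good c i U T) (h' : Good c j U T') (hl : el c l U = 0) :
    wd ((T - U) + (T' - U)) (D l) = 0 := by
  obtain ⟨u, t, h1, rfl, hut⟩ := good_params h h.hU
  obtain ⟨u', t', h1', rfl, hut'⟩ := good_params h' h'.hU
  have : u = 0 := param_eq h1.symm
  subst this
  have : u' = 0 := param_eq h1'.symm
  subst this
  have e1 := segre_good hodd h.hU (u := 0) (t := t) (by simpa using h)
  have e2 := segre_good hodd h'.hU (u := 0) (t := t') (by simpa using h')
  rw [prod3 hij hil hjl h.hU h'.hU hl h.mU] at e1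
  rw [prod3 (Ne.symm hij) hjl hil h'.hU h.hU hl h.mU, W_antisymm] at e2
  simp only [nz, hut.symm, hut'.symm, if_false, if_true] at e1 e2
  have hQ : Q c U * wd (D i) (D j) ≠ 0 := by
    intro hh; apply one_ne_zero (α := F); rw [← e1]; linear_combination wd (D i) (D l) * t * hh
  apply mul_left_cancel₀ hQ
  have : wd (U + t • D i - U + (U + t' • D j - U)) (D l) = t * wd (D i) (D l) + t' * wd (D j) (D l) := by
    simp [wd]; ring
  rw [this]; linear_combination e1 - e2

/-- membership on the third line -/
theorem third_mem {c : Option F → F} {l : Option F} {U V s : F × F} (hs : s ≠ 0) (h1 : wd s (D l) = 0)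
    (h2 : wd s (V - U) = 0) (hU : el c l U = 0) : el c l V = 0 := by
  have : wd (D l) (V - U) = 0 := by
    by_cases h : s.1 = 0
    · have h' : s.2 ≠ 0 := fun hh => hs (Prod.ext h hh)
      apply mul_left_cancel₀ h'
      simp only [wd] at *
      linear_combination (D l).2 * h2 - (V-U).2 * h1
    · apply mul_left_cancel₀ h
      simp only [wd] at *
      linear_combination (D l).1 * h2 - (V-U).1 * h1
  have h3 : el c l V = el c l U + wd (D l) (V - U) := by simp [el, wd]; ring
  rw [h3, hU, this, add_zero]
end
end Kak

namespace Kak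
open Finset

section
variable {F : Type*} [Field F] [Fintype F] [DecidableEq F]

theorem add_ne_zero_of_wd {a b : F × F} (h : wd a b ≠ 0) : a + b ≠ 0 := by
  intro hh; apply h
  have : b = -a := by rw [eq_neg_iff_add_eq_zero, add_comm]; exact hh
  rw [this]; simp [wd]; ring

theorem par_of {m x y : F × F} (hm : m ≠ 0) (h1 : wd m x = 0) (h2 : wd m y = 0) : wd x y = 0 := by
  by_cases h : m.1 = 0
  · have h' : m.2 ≠ 0 := fun hh => hm (Prod.ext h hh)
    apply mul_left_cancel₀ h'
    simp only [wd] at *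
    linear_combination x.2 * h2 - y.2 * h1
  · apply mul_left_cancel₀ h
    simp only [wd] at *
    linear_combination x.1 * h2 - y.1 * h1

theorem nuc_third (h2 : (2:F) ≠ 0) (hodd : Odd (Fintype.card F)) {c : Option F → F} {M i j k l : Option F}
    {U T T' V T'' : F × F} (hM : Nuc c M)
    (hij : i ≠ j) (hil : i ≠ l) (hjl : j ≠ l)
    (h : Good c i U T) (h' : Good c j U T') (hl : el c l U = 0) (hk : Good c k V T'') :
    el c l V = 0 := by
  by_cases hUV : U = V
  · rw [← hUV]; exact hl
  have hab := good_wd hij h h'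
  have c1 := good_cond hodd h hk hUV
  have c2 := good_cond hodd h' hk hUV
  have m1 := nuc_good h2 hodd hM h
  have m2 := nuc_good h2 hodd hM h'
  have m3 := nuc_good h2 hodd hM hk
  have hp : wd ((T' - U) - (T - U)) ((V - U) + (V - U) + (T'' - V) - (T - U)) = 0 := by
    apply par_of (D_ne M)
    · simp only [el, wd, Prod.fst_add, Prod.snd_add, Prod.fst_sub, Prod.snd_sub] at *
      linear_combination m2 - m1
    · simp only [el, wd, Prod.fst_add, Prod.snd_add, Prod.fst_sub, Prod.snd_sub] at *
      linear_combination m3 - m1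
  have := nucleus_alg h2 hab c1 c2 hp
  exact third_mem (add_ne_zero_of_wd hab) (good_third hodd hij hil hjl h h' hl) this hl

theorem good_pr (hodd : Odd (Fintype.card F)) {c : Option F → F} {i j k l : Option F}
    {U T1 T2 V T3 T4 : F × F} (hij : i ≠ j) (hkl : k ≠ l) (hUV : U ≠ V)
    (h1 : Good c i U T1) (h2 : Good c j U T2) (h3 : Good c k V T3) (h4 : Good c l V T4) :
    Pr (T1 - U) (T2 - U) (T3 - V) (T4 - V) (V - U) :=
  ⟨good_cond hodd h1 h3 hUV, good_cond hodd h1 h4 hUV, good_cond hodd h2 h3 hUV, good_cond hodd h2 h4 hUV,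
    good_wd hij h1 h2, good_wd hkl h3 h4⟩

theorem three_third (h2 : (2:F) ≠ 0) (hodd : Odd (Fintype.card F)) {c : Option F → F} {i j i' j' i'' j'' l : Option F}
    {U V W T1 T2 T3 T4 T5 T6 : F × F}
    (hij : i ≠ j) (hil : i ≠ l) (hjl : j ≠ l) (hij' : i' ≠ j') (hij'' : i'' ≠ j'')
    (hUV : U ≠ V) (hUW : U ≠ W) (hVW : V ≠ W) (hl : el c l U = 0)
    (h1 : Good c i U T1) (h1' : Good c j U T2) (h3 : Good c i' V T3) (h4 : Good c j' V T4)
    (h5 : Good c i'' W T5) (h6 : Good c j'' W T6) : el c l V = 0 := by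
  have p1 := good_pr hodd hij hij' hUV h1 h1' h3 h4
  have p2 := good_pr hodd hij hij'' hUW h1 h1' h5 h6
  have p3 := good_pr hodd hij' hij'' hVW h3 h4 h5 h6
  have e : W - V = (W - U) - (V - U) := by abel
  rw [e] at p3
  have := three_coll h2 p1 p2 p3
  exact third_mem (add_ne_zero_of_wd p1.ab) (good_third hodd hij hil hjl h1 h1' hl) this hl

theorem three_two (h2 : (2:F) ≠ 0) (hodd : Odd (Fintype.card F)) {c : Option F → F} {i j k i' j' : Option F}
    {U V T1 T2 T3 T4 T5 : F × F} (hij : i ≠ j) (hik : i ≠ k) (hjk : j ≠ k) (hij' : i' ≠ j')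
    (hUV : U ≠ V) (h1 : Good c i U T1) (h2' : Good c j U T2) (h3 : Good c k U T3)
    (h4 : Good c i' V T4) (h5 : Good c j' V T5) : False :=
  no_three_two h2 (good_pr hodd hij hij' hUV h1 h2' h4 h5) (good_pr hodd hik hij' hUV h1 h3 h4 h5)
    (good_pr hodd hjk hij' hUV h2' h3 h4 h5)

/-! ### counting -/

theorem dc (c : Option F → F) (S : Finset (F × F)) (T : Finset (Option F)) :
    ∑ A ∈ S, #{d ∈ T | el c d A = 0} = ∑ d ∈ T, #{A ∈ S | el c d A = 0} := by
  simp only [card_filter]; exact sum_comm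

def Ln (c : Option F → F) (d : Option F) : Finset (F × F) := {A | el c d A = 0}

theorem card_Ln (c : Option F → F) (d : Option F) : #(Ln c d) = Fintype.card F := by
  obtain ⟨e, he⟩ := exists_ne d
  obtain ⟨X, hX, -⟩ := inter c he.symm
  have : Ln c d = univ.map ⟨fun s : F => X + s • D d, fun s t h => param_inj h⟩ := by
    ext A; simp [Ln]
    constructor
    · intro h; obtain ⟨s, hs⟩ := param hX h; exact ⟨s, hs.symm⟩
    · rintro ⟨s, rfl⟩; exact el_on hX s
  rw [this, card_map]; simp

theorem card_inter (c : Option F → F) {i j : Option F} (h : i ≠ j) : #{A ∈ Ln c i | el c j A = 0} = 1 := by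
  obtain ⟨X, h1, h2⟩ := inter c h
  rw [card_eq_one]; refine ⟨X, ?_⟩
  ext A; simp [Ln]
  constructor
  · rintro ⟨h3, h4⟩; exact inter_unique h h3 h4 h1 h2
  · rintro rfl; exact ⟨h1, h2⟩

theorem sum_line (c : Option F → F) (d : Option F) : ∑ A ∈ Ln c d, mm c A = 2 * Fintype.card F := by
  unfold mm
  rw [dc, ← add_sum_erase _ _ (mem_univ d)]
  rw [sum_congr rfl (g := fun _ => 1)]
  · have : ({A ∈ Ln c d | el c d A = 0} : Finset (F × F)) = Ln c d := by
      ext A; simp [Ln]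
    rw [this, card_Ln]; simp; omega
  · intro k hk; exact card_inter c (ne_of_mem_erase hk).symm

theorem sum_mul_mm (c : Option F → F) (f : F × F → ℕ) :
    ∑ A, mm c A * f A = ∑ d, ∑ A ∈ Ln c d, f A := by
  simp only [mm, Ln, sum_filter, card_filter, sum_mul, ite_mul, one_mul, zero_mul]
  exact sum_comm

theorem sum_mm (c : Option F → F) : ∑ A, mm c A = Fintype.card F * (Fintype.card F + 1) := by
  have := sum_mul_mm c (fun _ => 1)
  simp only [mul_one] at this
  rw [this]; simp [card_Ln]; ring

theorem sum_mm_sq (c : Option F → F) : ∑ A, mm c A * mm c A = 2 * (Fintype.card F * (Fintype.card F + 1)) := by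
  rw [sum_mul_mm]; simp [sum_line]; ring

def ww (c : Option F → F) (A : F × F) : ℕ := (mm c A - 1) * (mm c A - 2)

theorem card_K (c : Option F → F) :
    2 * #{A | 1 ≤ mm c A} = Fintype.card F * (Fintype.card F + 1) + ∑ A, ww c A := by
  have key : ∀ A, ww c A + 3 * mm c A = mm c A * mm c A + 2 * (if 1 ≤ mm c A then 1 else 0) := by
    intro A
    unfold ww
    generalize mm c A = m
    rcases m with _ | _ | m
    · simp
    · simp
    · simp; ring
  have h := sum_congr rfl (fun A (_ : A ∈ (univ : Finset (F × F))) => key A)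
  rw [sum_add_distrib, sum_add_distrib, ← mul_sum, ← mul_sum, sum_mm, sum_mm_sq, ← card_filter] at h
  omega

def ee (c : Option F → F) (d : Option F) : ℕ := ∑ A ∈ Ln c d, (mm c A - 2)

theorem mm_pos {c : Option F → F} {d : Option F} {A : F × F} (h : A ∈ Ln c d) : 1 ≤ mm c A := by
  unfold mm; rw [Nat.one_le_iff_ne_zero, card_ne_zero]
  exact ⟨d, by simpa [Ln] using h⟩

theorem ee_eq (c : Option F → F) (d : Option F) : ee c d = #{A ∈ Ln c d | mm c A = 1} := by
  have key : ∀ A ∈ Ln c d, (mm c A - 2) + 2 = mm c A + (if mm c A = 1 then 1 else 0) := by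
    intro A hA
    have := mm_pos hA
    split_ifs <;> omega
  have h := sum_congr rfl key
  rw [sum_add_distrib, sum_add_distrib, ← card_filter, sum_line, sum_const, card_Ln] at h
  unfold ee
  simp at h
  omega

theorem nuc_of_ee {c : Option F → F} {d : Option F} (h : ee c d = 0) : Nuc c d := by
  intro X hX
  have hX' : X ∈ Ln c d := by simpa [Ln] using hX
  have h1 := mm_pos hX'
  have h2 := h
  unfold ee at h2
  rw [sum_eq_zero_iff] at h2
  have h3 := h2 X hX'
  rw [ee_eq, card_eq_zero, filter_eq_empty_iff] at h
  have := h hX'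
  omega

theorem good_of_ee {c : Option F → F} {d : Option F} (h : ee c d = 1) : ∃ U T, Good c d U T := by
  have h' := h
  rw [ee_eq, card_eq_one] at h'
  obtain ⟨T, hT⟩ := h'
  have hTm : T ∈ Ln c d ∧ mm c T = 1 := by
    have : T ∈ ({A ∈ Ln c d | mm c A = 1} : Finset _) := by rw [hT]; simp
    simpa using this
  obtain ⟨U, hU, hU1⟩ : ∃ U ∈ Ln c d, mm c U - 2 ≠ 0 := by
    by_contra hh; push Not at hh
    rw [ee, sum_eq_zero hh] at h; omega
  have hsum : (mm c U - 2) + ∑ A ∈ (Ln c d).erase U, (mm c A - 2) = 1 := by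
    rw [add_sum_erase _ (fun A => mm c A - 2) hU]; exact h
  have hz : ∑ A ∈ (Ln c d).erase U, (mm c A - 2) = 0 := by omega
  rw [sum_eq_zero_iff] at hz
  refine ⟨U, T, by simpa [Ln] using hU, by simpa [Ln] using hTm.1, by omega, hTm.2, ?_⟩
  intro X hX hXU hXT
  have hX' : X ∈ Ln c d := by simpa [Ln] using hX
  have h1 := mm_pos hX'
  have h2 := hz X (by simp [hXU, hX'])
  have h3 : mm c X ≠ 1 := by
    intro hh
    have : X ∈ ({A ∈ Ln c d | mm c A = 1} : Finset _) := by simp [hX', hh]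
    rw [hT] at this; simp at this; exact hXT this
  omega

theorem sum_ee (c : Option F → F) : 2 * ∑ d, ee c d ≤ 3 * ∑ A, ww c A := by
  unfold ee
  rw [← sum_mul_mm, mul_sum, mul_sum]
  apply sum_le_sum
  intro A _
  unfold ww
  generalize mm c A = m
  rcases m with _ | _ | _ | m
  · simp
  · simp
  · simp
  · simp only [Nat.reduceSubDiff]
    have : m + 1 + 1 + 1 - 1 = m + 2 := by omega
    have : m + 1 + 1 + 1 - 2 = m + 1 := by omega
    simp [*]; nlinarith

theorem tau_le (c : Option F → F) : 2 * #{A | 3 ≤ mm c A} ≤ ∑ A, ww c A := by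
  rw [card_filter, mul_sum]
  apply sum_le_sum
  intro A _
  split_ifs with h
  · unfold ww
    have h1 : 2 ≤ mm c A - 1 := by omega
    have h2 : 1 ≤ mm c A - 2 := by omega
    calc 2 * 1 = 2 * 1 := rfl
      _ ≤ _ := Nat.mul_le_mul h1 h2
  · simp
end
end Kak

namespace Kak
open Finset

section
variable {F : Type*} [Field F] [Fintype F] [DecidableEq F]

/-- uniqueness of the triple point on a good line -/
theorem good_uniq {c : Option F → F} {i : Option F} {U T A : F × F} (h : Good c i U T)
    (hA : el c i A = 0) (hm : 3 ≤ mm c A) : A = U := by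
  by_contra hne
  have hT : A ≠ T := by rintro rfl; have := h.mT; omega
  have := h.m2 A hA hne hT
  omega

theorem third_exists {c : Option F → F} {i j : Option F} {A : F × F} (hij : i ≠ j)
    (hm : mm c A = 3) : ∃ l, i ≠ l ∧ j ≠ l ∧ el c l A = 0 := by
  by_contra hh; push Not at hh
  have : ({k | el c k A = 0} : Finset (Option F)) ⊆ {i, j} := by
    intro k hk; simp at hk ⊢
    by_contra h; push Not at h
    exact hh k h.1.symm h.2.symm hk
  have := card_le_card this
  rw [card_pair hij] at this
  unfold mm at hm; omega

theorem ee_ge {c : Option F → F} {l : Option F} {J : Finset (F × F)}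
    (hJ : ∀ A ∈ J, el c l A = 0 ∧ 3 ≤ mm c A) : #J ≤ ee c l := by
  unfold ee
  calc #J = ∑ A ∈ J, 1 := by simp
    _ ≤ ∑ A ∈ J, (mm c A - 2) := sum_le_sum (fun A hA => by have := (hJ A hA).2; omega)
    _ ≤ _ := sum_le_sum_of_subset (fun A hA => by simpa [Ln] using (hJ A hA).1)

theorem fwd (h2 : (2:F) ≠ 0) (hodd : Odd (Fintype.card F)) (c : Option F → F)
    (hw : ∑ A, ww c A = Fintype.card F - 1) :
    ∃ d₀ : Option F, ∀ A, #{d | d ≠ d₀ ∧ el c d A = 0} ≤ 2 := by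
  set q := Fintype.card F with hq
  have hq1 : 1 < q := Fintype.one_lt_card
  have hse := sum_ee c
  have htau := tau_le c
  rw [hw] at hse htau
  let I : Finset (Option F) := {d | ee c d = 1}
  have hI : ∀ d, d ∈ I ↔ ee c d = 1 := by intro d; simp [I]
  have hex : ∀ d, ∃ U T, d ∈ I → Good c d U T := by
    intro d
    by_cases h : d ∈ I
    · obtain ⟨U, T, hh⟩ := good_of_ee ((hI d).mp h)
      exact ⟨U, T, fun _ => hh⟩
    · exact ⟨0, 0, fun h' => absurd h' h⟩
  choose U T hG using hex
  let J := I.image U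
  have hJ3 : ∀ A ∈ J, mm c A = 3 := by
    intro A hA
    obtain ⟨d, hd, rfl⟩ := mem_image.mp hA
    exact (hG d hd).mU
  have hJ : 2 * #J ≤ q - 1 := by
    refine le_trans (Nat.mul_le_mul_left 2 (card_le_card ?_)) htau
    intro A hA; simp [hJ3 A hA]
  have hcardO : Fintype.card (Option F) = q + 1 := by simp [hq]
  have hsumI : ∑ d : Option F, (if d ∈ I then 1 else 0) = #I := by simp
  -- fibers
  have hfib : #I = ∑ A ∈ J, #{d ∈ I | U d = A} :=
    card_eq_sum_card_fiberwise (fun d hd => mem_coe.mpr (mem_image_of_mem U (mem_coe.mp hd)))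
  have hfib3 : ∀ A ∈ J, #{d ∈ I | U d = A} ≤ 3 := by
    intro A hA
    rw [← hJ3 A hA]
    apply card_le_card
    intro d hd
    simp only [mem_filter] at hd
    simp [← hd.2, (hG d hd.1).hU]
  by_cases hnuc : ∃ M, Nuc c M
  · obtain ⟨M, hM⟩ := hnuc
    have hMI : M ∉ I := by
      intro h
      have := hM _ (hG M h).hU; rw [(hG M h).mU] at this; omega
    have he1 : ∀ d, d ≠ M → 1 ≤ ee c d := by
      intro d hd
      by_contra hh
      exact two_nuc h2 hodd hd (nuc_of_ee (by omega)) hM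
    have b1 : ∑ d : Option F, 2 ≤ ∑ d : Option F, (ee c d + (if d ∈ I then 1 else 0) + (if d = M then 2 else 0)) := by
      apply sum_le_sum
      intro d _
      by_cases hd : d = M
      · simp [hd]
      · have := he1 d hd
        by_cases hd' : d ∈ I
        · simp [hd']; omega
        · have h1 : ee c d ≠ 1 := fun h => hd' ((hI d).mpr h)
          omega
    rw [sum_add_distrib, sum_add_distrib, hsumI] at b1
    simp only [sum_const, card_univ, hcardO, sum_ite_eq', mem_univ, if_true, smul_eq_mul] at b1
    have hn1 : q + 3 ≤ 2 * #I := by omega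
    obtain ⟨i, hi, j, hj, hij, hUij⟩ : ∃ i ∈ I, ∃ j ∈ I, i ≠ j ∧ U i = U j := by
      apply exists_ne_map_eq_of_card_lt_of_maps_to (t := J)
      · omega
      · intro d hd; exact mem_coe.mpr (mem_image_of_mem U (mem_coe.mp hd))
    obtain ⟨l, hil, hjl, hl⟩ := third_exists hij (hG i hi).mU
    have hgj := hG j hj
    rw [← hUij] at hgj
    have hall : ∀ k ∈ I, el c l (U k) = 0 := fun k hk =>
      nuc_third h2 hodd hM hij hil hjl (hG i hi) hgj hl (hG k hk)
    have hlM : l ≠ M := by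
      rintro rfl
      have := hM _ hl; rw [(hG i hi).mU] at this; omega
    have hmain : ∀ d, d ≠ M → d ≠ l → d ∈ I := by
      by_cases hlI : l ∈ I
      · have hUl : ∀ k ∈ I, U k = U l := fun k hk =>
          good_uniq (hG l hlI) (hall k hk) (by rw [(hG k hk).mU])
        have hI3 : #I ≤ 3 := by
          rw [← (hG l hlI).mU]
          apply card_le_card
          intro k hk
          simp only [mem_filter, mem_univ, true_and]
          rw [← hUl k hk]; exact (hG k hk).hU
        have hq3 : q = 3 := by
          obtain ⟨r, hr⟩ := hodd
          omega
        have : I = univ.erase M := by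
          apply eq_of_subset_of_card_le
          · intro d hd; simp; rintro rfl; exact hMI hd
          · rw [card_erase_of_mem (mem_univ _), card_univ, hcardO]; omega
        intro d hd _
        rw [this]; simp [hd]
      · have hfib2 : ∀ A ∈ J, #{d ∈ I | U d = A} ≤ 2 := by
          intro A hA
          have hAl : el c l A = 0 := by
            obtain ⟨d, hd, rfl⟩ := mem_image.mp hA
            exact hall d hd
          have : #(insert l {d ∈ I | U d = A}) ≤ 3 := by
            rw [← hJ3 A hA]
            apply card_le_card
            intro d hd
            simp only [mem_insert, mem_filter] at hd
            rcases hd with rfl | hd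
            · simp [hAl]
            · simp [← hd.2, (hG d hd.1).hU]
          rw [card_insert_of_notMem (by simp [hlI])] at this
          omega
        have hn2 : #I ≤ 2 * #J := by
          rw [hfib]
          calc _ ≤ ∑ A ∈ J, 2 := sum_le_sum hfib2
            _ = _ := by simp [mul_comm]
        have hel : #J ≤ ee c l := by
          apply ee_ge
          intro A hA
          refine ⟨?_, (hJ3 A hA).ge⟩
          obtain ⟨d, hd, rfl⟩ := mem_image.mp hA
          exact hall d hd
        have b2 : ∑ d : Option F, (2 + if d = l then ee c l else 0) ≤ ∑ d : Option F, (ee c d + (if d ∈ I then 1 else 0) + (if d = M then 2 else 0) + (if d = l then 2 else 0)) := by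
          apply sum_le_sum
          intro d _
          by_cases hdl : d = l
          · subst hdl; simp; omega
          by_cases hd : d = M
          · simp [hd, hlM.symm]
          · have := he1 d hd
            by_cases hd' : d ∈ I
            · simp [hd', hdl]; omega
            · have h1 : ee c d ≠ 1 := fun h => hd' ((hI d).mpr h)
              simp [hdl, hd, hd']; omega
        rw [sum_add_distrib, sum_add_distrib, sum_add_distrib, sum_add_distrib, hsumI] at b2
        simp only [sum_const, card_univ, hcardO, sum_ite_eq', mem_univ, if_true, smul_eq_mul] at b2
        have : I = (univ.erase M).erase l := by
          apply eq_of_subset_of_card_le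
          · intro d hd; simp
            refine ⟨?_, ?_⟩
            · rintro rfl; exact hlI hd
            · rintro rfl; exact hMI hd
          · rw [card_erase_of_mem (by simp [hlM]), card_erase_of_mem (mem_univ _), card_univ, hcardO]; omega
        intro d hd hd'
        rw [this]; simp [hd, hd']
    refine ⟨l, fun A => ?_⟩
    by_cases hA : mm c A ≤ 2
    · refine le_trans (card_le_card ?_) hA
      intro d; simp
    · obtain ⟨k, hk, hkI⟩ : ∃ k, el c k A = 0 ∧ k ∈ I := by
        by_contra hh; push Not at hh
        have : ({k | el c k A = 0} : Finset (Option F)) ⊆ {l} := by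
          intro k hk
          simp only [mem_filter, mem_univ, true_and, mem_singleton] at hk ⊢
          by_contra hkl
          refine hh k hk (hmain k ?_ hkl)
          rintro rfl
          have := hM _ hk; omega
        have := card_le_card this
        rw [card_singleton] at this
        unfold mm at hA; omega
      have hAU := good_uniq (hG k hkI) hk (by omega)
      have hAl : el c l A = 0 := by rw [hAU]; exact hall k hkI
      have hA3 : mm c A = 3 := by rw [hAU]; exact (hG k hkI).mU
      have : ({k | el c k A = 0} : Finset (Option F)) = insert l ({d | d ≠ l ∧ el c d A = 0} : Finset (Option F)) := by
        ext d; simp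
        by_cases hd : d = l
        · simp [hd, hAl]
        · simp [hd]
      unfold mm at hA3
      rw [this, card_insert_of_notMem (by simp)] at hA3
      omega
  · exfalso
    push Not at hnuc
    have he1 : ∀ d, 1 ≤ ee c d := by
      intro d
      by_contra hh
      exact hnuc d (nuc_of_ee (by omega))
    have b1 : ∑ d : Option F, 2 ≤ ∑ d : Option F, (ee c d + (if d ∈ I then 1 else 0)) := by
      apply sum_le_sum
      intro d _
      have := he1 d
      by_cases hd' : d ∈ I
      · simp [hd']; omega
      · have h1 : ee c d ≠ 1 := fun h => hd' ((hI d).mpr h)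
        omega
    rw [sum_add_distrib, hsumI] at b1
    simp only [sum_const, card_univ, hcardO, smul_eq_mul] at b1
    have hn1 : q + 7 ≤ 2 * #I := by omega
    have hfib1 : ∀ A ∈ J, 1 ≤ #{d ∈ I | U d = A} := by
      intro A hA
      obtain ⟨d, hd, rfl⟩ := mem_image.mp hA
      rw [Nat.one_le_iff_ne_zero, card_ne_zero]
      exact ⟨d, by simp [hd]⟩
    by_cases h3 : ∃ A ∈ J, 3 ≤ #{d ∈ I | U d = A}
    · obtain ⟨A, hA, hA3⟩ := h3
      obtain ⟨i, j, k, hi, hj, hk, hij, hik, hjk⟩ := two_lt_card_iff.mp hA3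
      simp only [mem_filter] at hi hj hk
      have ho : ∀ B ∈ J.erase A, #{d ∈ I | U d = B} ≤ 1 := by
        intro B hB
        by_contra hh
        obtain ⟨i', j', hi', hj', hij'⟩ := one_lt_card_iff.mp (not_le.mp hh)
        simp only [mem_filter] at hi' hj'
        have g1 := hG i hi.1; rw [hi.2] at g1
        have g2 := hG j hj.1; rw [hj.2] at g2
        have g3 := hG k hk.1; rw [hk.2] at g3
        have g4 := hG i' hi'.1; rw [hi'.2] at g4
        have g5 := hG j' hj'.1; rw [hj'.2] at g5
        exact three_two h2 hodd hij hik hjk hij' (ne_of_mem_erase hB).symm g1 g2 g3 g4 g5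
      have : #I ≤ 3 + #(J.erase A) := by
        rw [hfib, ← add_sum_erase _ _ hA]
        apply add_le_add (hfib3 A hA)
        calc _ ≤ ∑ B ∈ J.erase A, 1 := sum_le_sum ho
          _ = _ := by simp
      rw [card_erase_of_mem hA] at this
      omega
    · push Not at h3
      let J2 : Finset (F × F) := {A ∈ J | 2 ≤ #{d ∈ I | U d = A}}
      have hn2 : #I ≤ #J + #J2 := by
        rw [hfib]
        calc _ ≤ ∑ A ∈ J, (1 + if 2 ≤ #{d ∈ I | U d = A} then 1 else 0) := by
              apply sum_le_sum
              intro A hA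
              have := h3 A hA
              split_ifs <;> omega
          _ = _ := by rw [sum_add_distrib, ← card_filter]; simp [J2]
      have hJ2 : ∀ A ∈ J2, mm c A = 3 ∧ ∃ i j T1 T2, i ≠ j ∧ Good c i A T1 ∧ Good c j A T2 := by
        intro A hA
        simp only [J2, mem_filter] at hA
        refine ⟨hJ3 A hA.1, ?_⟩
        obtain ⟨i', j', hi', hj', hij'⟩ := one_lt_card_iff.mp hA.2
        simp only [mem_filter] at hi' hj'
        have g4 := hG i' hi'.1; rw [hi'.2] at g4
        have g5 := hG j' hj'.1; rw [hj'.2] at g5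
        exact ⟨i', j', _, _, hij', g4, g5⟩
      have hr2 : 4 ≤ #J2 := by omega
      obtain ⟨A, hA⟩ : J2.Nonempty := by rw [← card_pos]; omega
      obtain ⟨hAm, i, j, T1, T2, hij, g1, g2⟩ := hJ2 A hA
      obtain ⟨l, hil, hjl, hl⟩ := third_exists hij hAm
      have hon : ∀ V ∈ J2, el c l V = 0 := by
        intro V hV
        by_cases hVA : V = A
        · rw [hVA]; exact hl
        obtain ⟨W, hW⟩ : ((J2.erase A).erase V).Nonempty := by
          rw [← card_pos, card_erase_of_mem (by simp [hVA, hV]), card_erase_of_mem hA]; omega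
        simp only [mem_erase] at hW
        obtain ⟨-, i', j', T3, T4, hij', g3, g4⟩ := hJ2 V hV
        obtain ⟨-, i'', j'', T5, T6, hij'', g5, g6⟩ := hJ2 W hW.2.2
        exact three_third h2 hodd hij hil hjl hij' hij'' (Ne.symm hVA) (Ne.symm hW.2.1) (Ne.symm hW.1) hl
          g1 g2 g3 g4 g5 g6
      have hel : #J2 ≤ ee c l := ee_ge (fun V hV => ⟨hon V hV, (hJ2 V hV).1.ge⟩)
      have hlI : l ∉ I := by rw [hI]; omega
      have b2 : ∑ d : Option F, (2 + if d = l then ee c l else 0) ≤ ∑ d : Option F, (ee c d + (if d ∈ I then 1 else 0) + (if d = l then 2 else 0)) := by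
        apply sum_le_sum
        intro d _
        by_cases hdl : d = l
        · subst hdl; simp; omega
        · have := he1 d
          by_cases hd' : d ∈ I
          · simp [hd', hdl]; omega
          · have h1 : ee c d ≠ 1 := fun h => hd' ((hI d).mpr h)
            simp [hdl, hd']; omega
      rw [sum_add_distrib, sum_add_distrib, sum_add_distrib, hsumI] at b2
      simp only [sum_const, card_univ, hcardO, sum_ite_eq', mem_univ, if_true, smul_eq_mul] at b2
      omega
end
end Kak

namespace Kak
open Finset

section
variable {F : Type*} [Field F] [Fintype F] [DecidableEq F]

/-- multiplicity with one direction left out -/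
def cc (c : Option F → F) (d₀ : Option F) (A : F × F) : ℕ := #{d ∈ univ.erase d₀ | el c d A = 0}

theorem cc_sum_line (c : Option F → F) (d₀ : Option F) (s : F) :
    ∑ A with wd (D d₀) A = s, cc c d₀ A = Fintype.card F := by
  unfold cc
  rw [dc, sum_congr rfl (g := fun _ => 1)]
  · simp
  · intro k hk
    have hne := ne_of_mem_erase hk
    have := card_inter (Function.update c d₀ s) hne.symm
    rw [← this]
    congr 1
    ext A
    simp [Ln, el, hne, sub_eq_zero]

theorem cc_sum (c : Option F → F) (d₀ : Option F) : ∑ A, cc c d₀ A = Fintype.card F * Fintype.card F := by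
  rw [← sum_fiberwise univ (fun A => wd (D d₀) A)]
  simp [cc_sum_line]

theorem cc_line (c : Option F → F) (d₀ : Option F) {d : Option F} (hd : d ≠ d₀) :
    ∑ A ∈ Ln c d, cc c d₀ A = 2 * Fintype.card F - 1 := by
  have h : ∀ A ∈ Ln c d, mm c A = cc c d₀ A + (if el c d₀ A = 0 then 1 else 0) := by
    intro A _
    unfold mm cc
    rw [filter_erase]
    split_ifs with h
    · rw [card_erase_add_one]; simp [h]
    · rw [erase_eq_of_notMem]; simp; simp [h]
  have h1 := sum_line c d
  rw [sum_congr rfl h, sum_add_distrib, ← card_filter, card_inter c hd] at h1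
  omega

theorem cc_sum_sq (c : Option F → F) (d₀ : Option F) :
    ∑ A, cc c d₀ A * cc c d₀ A = Fintype.card F * (2 * Fintype.card F - 1) := by
  have : ∑ A, cc c d₀ A * cc c d₀ A = ∑ d ∈ univ.erase d₀, ∑ A ∈ Ln c d, cc c d₀ A := by
    have h : ∀ f : F × F → ℕ, ∑ A, cc c d₀ A * f A = ∑ d ∈ univ.erase d₀, ∑ A ∈ Ln c d, f A := by
      intro f
      unfold cc
      simp only [Ln, sum_filter, card_filter, sum_mul, ite_mul, one_mul, zero_mul]
      exact sum_comm
    exact h _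
  rw [this, sum_congr rfl (fun d hd => cc_line c d₀ (ne_of_mem_erase hd))]
  simp

theorem bwd (hodd : Odd (Fintype.card F)) (c : Option F → F) (d₀ : Option F)
    (h : ∀ A, cc c d₀ A ≤ 2) : ∑ A, ww c A = Fintype.card F - 1 := by
  set q := Fintype.card F with hq
  have hq1 : 1 < q := Fintype.one_lt_card
  have hone : #{A | cc c d₀ A = 1} = q := by
    have key : ∀ A, (if cc c d₀ A = 1 then 1 else 0) + cc c d₀ A * cc c d₀ A = 2 * cc c d₀ A := by
      intro A
      have := h A
      generalize cc c d₀ A = m at *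
      interval_cases m <;> simp
    have hs := sum_congr rfl (fun A (_ : A ∈ (univ : Finset (F × F))) => key A)
    rw [sum_add_distrib, ← card_filter, ← mul_sum, cc_sum, cc_sum_sq, ← hq] at hs
    obtain ⟨r, hr⟩ : ∃ r, q = r + 1 := ⟨q - 1, by omega⟩
    rw [hr] at hs ⊢
    have : 2 * (r + 1) - 1 = 2 * r + 1 := by omega
    rw [this] at hs
    nlinarith
  have hfib : #{A | cc c d₀ A = 1} = ∑ s : F, #{A ∈ ({A | cc c d₀ A = 1} : Finset (F × F)) | wd (D d₀) A = s} :=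
    card_eq_sum_card_fiberwise (fun A _ => by simp)
  have hge : ∀ s : F, 1 ≤ #{A ∈ ({A | cc c d₀ A = 1} : Finset (F × F)) | wd (D d₀) A = s} := by
    intro s
    by_contra hh
    have h0 : #{A ∈ ({A | cc c d₀ A = 1} : Finset (F × F)) | wd (D d₀) A = s} = 0 := by omega
    rw [card_eq_zero] at h0
    have h1 := cc_sum_line c d₀ s
    have h3 : 2 ∣ ∑ A with wd (D d₀) A = s, cc c d₀ A := by
      apply dvd_sum
      intro A hA
      have h4 : cc c d₀ A ≠ 1 := by
        intro h5
        have : A ∈ ({A ∈ ({A | cc c d₀ A = 1} : Finset (F × F)) | wd (D d₀) A = s} : Finset _) := by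
          simp at hA; simp [h5, hA]
        rw [h0] at this; simp at this
      have := h A
      omega
    rw [h1] at h3
    obtain ⟨r, hr⟩ := hodd
    omega
  have heq : #{A ∈ ({A | cc c d₀ A = 1} : Finset (F × F)) | wd (D d₀) A = c d₀} = 1 := by
    rw [hone, ← add_sum_erase _ _ (mem_univ (c d₀))] at hfib
    have : ∑ s ∈ univ.erase (c d₀), 1 ≤ ∑ s ∈ univ.erase (c d₀), #{A ∈ ({A | cc c d₀ A = 1} : Finset (F × F)) | wd (D d₀) A = s} :=
      sum_le_sum (fun s _ => hge s)
    simp only [sum_const, card_erase_of_mem (mem_univ _), card_univ, ← hq, smul_eq_mul, mul_one] at this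
    have := hge (c d₀)
    omega
  have hline := cc_sum_line c d₀ (c d₀)
  have hw : ∀ A, ww c A + (if wd (D d₀) A = c d₀ then (if cc c d₀ A = 1 then 1 else 0) else 0)
      = (if wd (D d₀) A = c d₀ then cc c d₀ A else 0) := by
    intro A
    have hA := h A
    have hm : mm c A = cc c d₀ A + (if wd (D d₀) A = c d₀ then 1 else 0) := by
      unfold mm cc
      rw [filter_erase]
      split_ifs with h
      · rw [card_erase_add_one]; exact mem_filter.mpr ⟨mem_univ _, by simp [el, h]⟩
      · rw [erase_eq_of_notMem]; simp; simp [el, h, sub_eq_zero]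
    unfold ww
    rw [hm]
    generalize cc c d₀ A = m at *
    split_ifs <;> interval_cases m <;> simp_all
  have hs := sum_congr rfl (fun A (_ : A ∈ (univ : Finset (F × F))) => hw A)
  rw [sum_add_distrib, ← sum_filter, ← sum_filter, ← sum_filter, ← card_eq_sum_ones, hline] at hs
  rw [filter_filter] at heq
  rw [filter_filter] at hs
  simp only [and_comm] at hs heq
  omega

theorem line_form (d : Option F) (L : Set (F × F)) (h : match d with
  | none => ∃ c : F, L = {p : F × F | p.1 = c}
  | some m => ∃ b : F, L = {p : F × F | p.2 = m * p.1 + b}) :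
    ∃ c : F, ∀ A, A ∈ L ↔ wd (D d) A - c = 0 := by
  cases d with
  | none =>
    obtain ⟨b, rfl⟩ := h
    refine ⟨-b, fun A => ?_⟩
    simp [wd, D]
    constructor
    · intro h; rw [h]; ring
    · intro h; linear_combination -h
  | some m =>
    obtain ⟨b, rfl⟩ := h
    refine ⟨b, fun A => ?_⟩
    simp [wd, D]
    constructor
    · intro h; rw [h]; ring
    · intro h; linear_combination h
end
end Kak

/-- **Blokhuis–Mazzocca, equality case.** For `q` an odd prime power, a Kakeya
set `K = ⋃ d, L d` in `AG(2,q)` satisfies `|K| = q(q+1)/2 + (q-1)/2`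
(i.e. `2|K| = q(q+1) + (q-1)`) if and only if there is a direction `d₀` such
that no point of `AG(2,q)` lies on three or more of the lines `L d` with
`d ≠ d₀` (equivalently, these `q` lines together with the line at infinity
form a dual oval, so `K` is of type `K(𝒪, ℓ, ℓ_A)`). -/
theorem kakeya_sharp_equality_iff {F : Type*} [Field F] [Fintype F] (q : ℕ)
    (hq : Fintype.card F = q) (hodd : Odd q)
    (L : Option F → Set (F × F)) (hL : ∀ d, IsLineWithDir d (L d))
    (K : Set (F × F)) (hK : K = ⋃ d, L d) :
    2 * K.ncard = q * (q + 1) + (q - 1) ↔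
      ∃ d₀ : Option F, ∀ A : F × F,
        Nat.card {d : Option F // d ≠ d₀ ∧ A ∈ L d} ≤ 2 := by
  classical
  subst hq
  have h2 : (2:F) ≠ 0 := by
    intro h
    have hc : ringChar F = 2 := by
      have hd : ringChar F ∣ 2 := (ringChar.spec F 2).mp (by exact_mod_cast h)
      rcases (Nat.dvd_prime Nat.prime_two).mp hd with h1 | h1
      · exact absurd h1 (CharP.ringChar_ne_one)
      · exact h1
    have := FiniteField.even_card_of_char_two hc
    rw [← Nat.not_even_iff_odd] at hodd
    exact hodd (Nat.even_iff.mpr this)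
  choose c hc using fun d => Kak.line_form d (L d) (hL d)
  have hc' : ∀ d A, A ∈ L d ↔ Kak.el c d A = 0 := hc
  have hKc : K.ncard = ((Finset.univ.filter fun A => 1 ≤ Kak.mm c A) : Finset (F × F)).card := by
    rw [← Set.ncard_coe_finset]
    congr 1
    ext A
    rw [hK]
    simp only [Set.mem_iUnion, hc', Finset.coe_filter, Finset.mem_univ, true_and, Set.mem_setOf_eq]
    unfold Kak.mm
    rw [Nat.one_le_iff_ne_zero, Finset.card_ne_zero]
    constructor
    · rintro ⟨d, hd⟩; exact ⟨d, by simpa using hd⟩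
    · rintro ⟨d, hd⟩; exact ⟨d, by simpa using hd⟩
  have hcount : ∀ d₀ A, Nat.card {d : Option F // d ≠ d₀ ∧ A ∈ L d}
      = ((Finset.univ.filter fun d => d ≠ d₀ ∧ Kak.el c d A = 0) : Finset (Option F)).card := by
    intro d₀ A
    rw [Nat.card_eq_fintype_card, Fintype.card_subtype]
    congr 1
    ext d
    simp [hc']
  simp only [hcount]
  rw [hKc, Kak.card_K]
  constructor
  · intro h
    exact Kak.fwd h2 hodd c (by omega)
  · rintro ⟨d₀, h⟩
    rw [Kak.bwd hodd c d₀ (fun A => ?_)]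
    refine le_trans (Finset.card_le_card ?_) (h A)
    intro d
    simp
end

section
/- Let q be an odd prime power and let Ω be a set of q+2 points in PG(2,q) possessing an internal nucleus. Then the number of lines of PG(2,q) that intersect Ω is at least (q+1)(q+2)/2 + (q−1)/2, i.e., at least (q² + 4q + 1)/2. -/
/-- A point of `PG(2,q)`: a 1-dimensional linear subspace of `F³`. -/
abbrev ProjPoint (F : Type*) [Field F] :=
  {W : Submodule F (Fin 3 → F) // Module.finrank F W = 1}

/-- A line of `PG(2,q)`: a 2-dimensional linear subspace of `F³`. -/
abbrev ProjLine (F : Type*) [Field F] :=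
  {W : Submodule F (Fin 3 → F) // Module.finrank F W = 2}

/-- `P` is an internal nucleus of `Ω` if `P ∈ Ω` and every line through `P`
meets `Ω` in exactly one point other than `P`. -/
def IsInternalNucleus {F : Type*} [Field F] (Ω : Set (ProjPoint F)) (P : ProjPoint F) : Prop :=
  P ∈ Ω ∧ ∀ L : ProjLine F, P.1 ≤ L.1 →
    ∃! Q : ProjPoint F, Q ∈ Ω ∧ Q ≠ P ∧ Q.1 ≤ L.1


namespace Nuc

open Configuration

variable {F : Type*} [Field F]

theorem pt_rep (P : ProjPoint F) : ∃ v : Fin 3 → F, v ≠ 0 ∧ P.1 = Submodule.span F {v} := by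
  obtain ⟨v, hv, h⟩ := finrank_eq_one_iff'.1 P.2
  refine ⟨v, by simpa using hv, le_antisymm ?_ ?_⟩
  · intro w hw
    obtain ⟨c, hc⟩ := h ⟨w, hw⟩
    exact Submodule.mem_span_singleton.2 ⟨c, by simpa using congrArg Subtype.val hc⟩
  · simp

/-- The point spanned by a nonzero vector. -/
def mkPt (v : Fin 3 → F) (hv : v ≠ 0) : ProjPoint F :=
  ⟨Submodule.span F {v}, finrank_span_singleton hv⟩

theorem finrank_ker_dual (f : (Fin 3 → F) →ₗ[F] F) (hf : f ≠ 0) :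
    Module.finrank F (LinearMap.ker f) = 2 := by
  have h := LinearMap.finrank_range_add_finrank_ker f
  rw [LinearMap.range_eq_top.2 (LinearMap.surjective hf)] at h
  simp at h
  omega

/-- The line that is the kernel of a nonzero functional. -/
def mkLn (f : (Fin 3 → F) →ₗ[F] F) (hf : f ≠ 0) : ProjLine F :=
  ⟨LinearMap.ker f, finrank_ker_dual f hf⟩

theorem ln_rep (L : ProjLine F) :
    ∃ f : (Fin 3 → F) →ₗ[F] F, f ≠ 0 ∧ L.1 = LinearMap.ker f := by
  have hlt : L.1 < ⊤ := by
    rw [lt_top_iff_ne_top]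
    intro h
    have := L.2
    rw [h] at this
    simp at this
  obtain ⟨f, hf, hle⟩ := Submodule.exists_le_ker_of_lt_top L.1 hlt
  exact ⟨f, hf, Submodule.eq_of_le_of_finrank_eq hle (by rw [L.2, finrank_ker_dual f hf])⟩

theorem sup_rank {P Q : ProjPoint F} (h : P ≠ Q) : Module.finrank F ↥(P.1 ⊔ Q.1) = 2 := by
  have h1 := Submodule.finrank_sup_add_finrank_inf_eq P.1 Q.1
  rw [P.2, Q.2] at h1
  have h2 : Module.finrank F ↥(P.1 ⊓ Q.1) ≤ 1 := by
    have := Submodule.finrank_mono (inf_le_left : P.1 ⊓ Q.1 ≤ P.1)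
    rwa [P.2] at this
  have h3 : Module.finrank F ↥(P.1 ⊓ Q.1) ≠ 1 := by
    intro h3
    have a := Submodule.eq_of_le_of_finrank_eq (inf_le_left : P.1 ⊓ Q.1 ≤ P.1) (by rw [h3, P.2])
    have b := Submodule.eq_of_le_of_finrank_eq (inf_le_right : P.1 ⊓ Q.1 ≤ Q.1) (by rw [h3, Q.2])
    exact h (Subtype.ext (a.symm.trans b))
  omega

theorem inf_rank {P Q : ProjLine F} (h : P ≠ Q) : Module.finrank F ↥(P.1 ⊓ Q.1) = 1 := by
  have h1 := Submodule.finrank_sup_add_finrank_inf_eq P.1 Q.1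
  rw [P.2, Q.2] at h1
  have h2 : Module.finrank F ↥(P.1 ⊔ Q.1) ≤ 3 := by
    simpa using Submodule.finrank_le (P.1 ⊔ Q.1)
  have h4 : 2 ≤ Module.finrank F ↥(P.1 ⊔ Q.1) := by
    have := Submodule.finrank_mono (le_sup_left : P.1 ≤ P.1 ⊔ Q.1)
    rwa [P.2] at this
  have h3 : Module.finrank F ↥(P.1 ⊔ Q.1) ≠ 2 := by
    intro h3
    have a := Submodule.eq_of_le_of_finrank_eq (le_sup_left : P.1 ≤ P.1 ⊔ Q.1) (by rw [h3, P.2])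
    have b := Submodule.eq_of_le_of_finrank_eq (le_sup_right : Q.1 ≤ P.1 ⊔ Q.1) (by rw [h3, Q.2])
    exact h (Subtype.ext (a.trans b.symm))
  omega

instance instMem : Membership (ProjPoint F) (ProjLine F) := ⟨fun L P => P.1 ≤ L.1⟩

theorem mem_def (P : ProjPoint F) (L : ProjLine F) : P ∈ L ↔ P.1 ≤ L.1 := Iff.rfl

theorem mk_mem_mk (v : Fin 3 → F) (hv : v ≠ 0) (f : (Fin 3 → F) →ₗ[F] F) (hf : f ≠ 0) :
    mkPt v hv ∈ mkLn f hf ↔ f v = 0 := by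
  simp [mem_def, mkPt, mkLn]

theorem proj_ne (i : Fin 3) : (LinearMap.proj i : (Fin 3 → F) →ₗ[F] F) ≠ 0 := by
  intro h
  have := LinearMap.congr_fun h (fun _ => 1)
  simp at this

noncomputable instance instPlane : ProjectivePlane (ProjPoint F) (ProjLine F) where
  exists_point L := by
    obtain ⟨f, hf, hL⟩ := ln_rep L
    obtain ⟨v, hv⟩ : ∃ v, f v ≠ 0 := by
      by_contra! h
      exact hf (LinearMap.ext h)
    have hv0 : v ≠ 0 := by rintro rfl; simp at hv
    exact ⟨mkPt v hv0, by simpa [mem_def, hL, mkPt] using hv⟩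
  exists_line P := by
    obtain ⟨v, hv, hP⟩ := pt_rep P
    obtain ⟨i, hi⟩ := Function.ne_iff.1 hv
    exact ⟨mkLn (LinearMap.proj i) (proj_ne i), by simpa [mem_def, hP, mkLn] using hi⟩
  eq_or_eq := by
    intro p₁ p₂ l₁ l₂ h1 h2 h3 h4
    by_cases h : p₁ = p₂
    · exact Or.inl h
    · right
      have a := Submodule.eq_of_le_of_finrank_eq (sup_le h1 h2) (by rw [sup_rank h, l₁.2])
      have b := Submodule.eq_of_le_of_finrank_eq (sup_le h3 h4) (by rw [sup_rank h, l₂.2])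
      exact Subtype.ext (a.symm.trans b)
  mkPoint := fun {l₁ l₂} h => ⟨l₁.1 ⊓ l₂.1, inf_rank h⟩
  mkPoint_ax := fun h => ⟨inf_le_left, inf_le_right⟩
  mkLine := fun {p₁ p₂} h => ⟨p₁.1 ⊔ p₂.1, sup_rank h⟩
  mkLine_ax := fun h => ⟨le_sup_left, le_sup_right⟩
  exists_config := by
    refine ⟨mkPt ![0, 1, 1] ?_, mkPt ![1, 0, 0] ?_, mkPt ![1, 0, 1] ?_,
      mkLn (LinearMap.proj 0) (proj_ne 0), mkLn (LinearMap.proj 1) (proj_ne 1),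
      mkLn (LinearMap.proj 2) (proj_ne 2), ?_⟩ <;> simp [mk_mem_mk]

/-- Jamison type bound. -/
theorem jamison [Fintype F] (S : Finset (ProjLine F)) (N : ProjPoint F) (l₀ : ProjLine F)
    (hN : N ∉ l₀) (hS : ∀ L ∈ S, N ∉ L)
    (hcov : ∀ Z : ProjPoint F, Z ≠ N → Z ∉ l₀ → ∃ L ∈ S, Z ∈ L) :
    2 * (Fintype.card F - 1) ≤ S.card := by
  classical
  obtain ⟨v, hv, hNv⟩ := pt_rep N
  choose f hf hLf using (ln_rep (F := F))
  have hmem : ∀ (w : Fin 3 → F) (hw : w ≠ 0) (L : ProjLine F), mkPt w hw ∈ L ↔ f L w = 0 := by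
    intro w hw L
    simp [mem_def, mkPt, hLf L]
  have hNe : N = mkPt v hv := Subtype.ext hNv
  let b := Module.finBasisOfFinrankEq F l₀.1 l₀.2
  let w : (Fin 2 → F) → (Fin 3 → F) := fun x => v + ∑ i, x i • (b i : Fin 3 → F)
  have hb : ∀ i, f l₀ (b i : Fin 3 → F) = 0 := by
    intro i
    exact LinearMap.mem_ker.1 ((hLf l₀).le (b i).2)
  have hv0 : f l₀ v ≠ 0 := by
    rw [hNe, hmem] at hN
    exact hN
  have hw0 : ∀ x, f l₀ (w x) = f l₀ v := by
    intro x
    simp [w, hb]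
  have hwne : ∀ x, w x ≠ 0 := by
    intro x h
    have := hw0 x
    rw [h, map_zero] at this
    exact hv0 this.symm
  let lin : ProjLine F → MvPolynomial (Fin 2) F := fun L =>
    MvPolynomial.C (f L v) + ∑ i, MvPolynomial.C (f L (b i)) * MvPolynomial.X i
  have hlin : ∀ L x, MvPolynomial.eval x (lin L) = f L (w x) := by
    intro L x
    simp [lin, w, mul_comm]
  have hdeg : ∀ L, (lin L).totalDegree ≤ 1 := by
    intro L
    refine (MvPolynomial.totalDegree_add _ _).trans (max_le (by simp) ?_)
    refine MvPolynomial.totalDegree_finsetSum_le ?_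
    intro i _
    refine (MvPolynomial.totalDegree_mul _ _).trans ?_
    simp
  let G := ∏ L ∈ S, lin L
  have hG : G.totalDegree ≤ S.card := by
    refine (MvPolynomial.totalDegree_finsetProd _ _).trans ?_
    refine (Finset.sum_le_card_nsmul S _ 1 (fun L _ => hdeg L)).trans (by simp)
  by_contra hlt
  have hsum := MvPolynomial.sum_eval_eq_zero G (by
    rw [Fintype.card_fin]
    omega)
  have hGe : ∀ x, MvPolynomial.eval x G = ∏ L ∈ S, f L (w x) := by
    intro x
    simp only [G, map_prod, hlin]
  rw [Finset.sum_eq_single 0] at hsum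
  · rw [hGe, Finset.prod_eq_zero_iff] at hsum
    obtain ⟨L, hL, h0⟩ := hsum
    apply hS L hL
    rw [hNe, hmem]
    simpa [w] using h0
  · intro x _ hx
    rw [hGe]
    obtain ⟨L, hL, hZ⟩ := hcov (mkPt (w x) (hwne x)) (by
      intro h
      apply hx
      have h1 : w x ∈ N.1 := by
        rw [← h]
        exact Submodule.mem_span_singleton_self _
      rw [hNv, Submodule.mem_span_singleton] at h1
      obtain ⟨c, hc⟩ := h1
      have h2 := hw0 x
      rw [← hc, map_smul, smul_eq_mul] at h2
      have hc1 : c = 1 := by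
        exact mul_right_cancel₀ hv0 (by rw [h2, one_mul])
      rw [hc1, one_smul] at hc
      have h3 : ∑ i, x i • (b i : Fin 3 → F) = 0 := by
        simpa [w] using hc
      have h4 : ∑ i, x i • b i = 0 := by
        apply Subtype.ext
        simpa using h3
      funext i
      exact Fintype.linearIndependent_iff.1 b.linearIndependent x h4 i) (by
      rw [hmem, hw0]
      exact hv0)
    exact Finset.prod_eq_zero hL ((hmem _ _ _).1 hZ)
  · simp

theorem prod_eq_neg_one [Fintype F] {α : Type*} (A : Finset α) (g : α → F)
    (h0 : ∀ a ∈ A, g a ≠ 0) (hinj : Set.InjOn g A) (hc : A.card + 1 = Fintype.card F) :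
    ∏ a ∈ A, g a = -1 := by
  classical
  have himg : A.image g = Finset.univ.erase (0 : F) := by
    apply Finset.eq_of_subset_of_card_le
    · intro x hx
      obtain ⟨a, ha, rfl⟩ := Finset.mem_image.1 hx
      simpa using h0 a ha
    · rw [Finset.card_image_of_injOn hinj, Finset.card_erase_of_mem (Finset.mem_univ _),
        Finset.card_univ]
      omega
  rw [← Finset.prod_image (f := fun x => x) (g := g) hinj, himg]
  have h := FiniteField.prod_univ_units_id_eq_neg_one (K := F)
  have h2 := congrArg (Units.coeHom F) h
  rw [map_prod] at h2
  simp only [Units.coeHom_apply, Units.val_neg, Units.val_one] at h2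
  rw [← h2]
  symm
  refine Finset.prod_bij (fun u _ => (u : F)) ?_ ?_ ?_ ?_
  · intro u _; simp
  · intro u _ u' _ h; exact Units.ext h
  · intro x hx
    exact ⟨Units.mk0 x (by simpa using hx), by simp, rfl⟩
  · intro u _; rfl

theorem nuc_unique {Ω : Set (ProjPoint F)} {P A B : ProjPoint F} (hP : IsInternalNucleus Ω P)
    {L : ProjLine F} (hL : P ∈ L) (hA : A ∈ Ω) (hB : B ∈ Ω) (hAP : A ≠ P) (hBP : B ≠ P)
    (hAL : A ∈ L) (hBL : B ∈ L) : A = B :=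
  (hP.2 L hL).unique ⟨hA, hAP, hAL⟩ ⟨hB, hBP, hBL⟩

/-- One step of Segre's computation. -/
theorem segre_step [Fintype F] {Ω : Set (ProjPoint F)} {P : ProjPoint F}
    (hP : IsInternalNucleus Ω P) (v : ProjPoint F → (Fin 3 → F))
    (hv : ∀ Q : ProjPoint F, Q.1 = Submodule.span F {v Q})
    (f g : (Fin 3 → F) →ₗ[F] F) (hf : f (v P) = 0) (hg : g (v P) = 0)
    (M : ProjPoint F) (hgM : g (v M) = 0) (hfM : f (v M) ≠ 0)
    (A : Finset (ProjPoint F)) (hA : ∀ Q ∈ A, Q ∈ Ω ∧ Q ≠ P ∧ f (v Q) ≠ 0 ∧ g (v Q) ≠ 0)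
    (hc : A.card + 1 = Fintype.card F) :
    ∏ Q ∈ A, f (v Q) / g (v Q) = -1 := by
  refine prod_eq_neg_one A _ ?_ ?_ hc
  · intro Q hQ
    exact div_ne_zero (hA Q hQ).2.2.1 (hA Q hQ).2.2.2
  · intro Q hQ R hR h
    obtain ⟨hQ1, hQ2, hQ3, hQ4⟩ := hA Q hQ
    obtain ⟨hR1, hR2, hR3, hR4⟩ := hA R hR
    rw [div_eq_div_iff hQ4 hR4] at h
    let k : (Fin 3 → F) →ₗ[F] F := g (v R) • f - f (v R) • g
    have hk : k ≠ 0 := by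
      intro h0
      have := LinearMap.congr_fun h0 (v M)
      simp [k, hgM, hfM, hR4] at this
    have hmem : ∀ Q : ProjPoint F, k (v Q) = 0 → Q ∈ mkLn k hk := by
      intro Q hQ
      simp [mem_def, mkLn, hv Q, hQ]
    refine nuc_unique hP (hmem P ?_) hQ1 hR1 hQ2 hR2 (hmem Q ?_) (hmem R ?_)
    · simp [k, hf, hg]
    · simp only [k, LinearMap.sub_apply, LinearMap.smul_apply, smul_eq_mul]
      linear_combination h
    · simp only [k, LinearMap.sub_apply, LinearMap.smul_apply, smul_eq_mul]
      ring

/-- For odd `q` there are at most two internal nuclei. -/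
theorem segre [Fintype F] (hodd : Odd (Fintype.card F)) (Ω : Finset (ProjPoint F))
    (hΩ : Ω.card = Fintype.card F + 2) {P₁ P₂ P₃ : ProjPoint F}
    (h₁ : IsInternalNucleus (Ω : Set (ProjPoint F)) P₁)
    (h₂ : IsInternalNucleus (Ω : Set (ProjPoint F)) P₂)
    (h₃ : IsInternalNucleus (Ω : Set (ProjPoint F)) P₃)
    (h12 : P₁ ≠ P₂) (h13 : P₁ ≠ P₃) (h23 : P₂ ≠ P₃) : False := by
  classical
  choose v hv0 hv using (pt_rep (F := F))
  -- for two nuclei, a functional vanishing on the joining line, nonzero at other points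
  have key : ∀ P Q : ProjPoint F, P ≠ Q → IsInternalNucleus (Ω : Set (ProjPoint F)) P →
      IsInternalNucleus (Ω : Set (ProjPoint F)) Q → ∃ f : (Fin 3 → F) →ₗ[F] F,
      f (v P) = 0 ∧ f (v Q) = 0 ∧ ∀ R ∈ Ω, R ≠ P → R ≠ Q → f (v R) ≠ 0 := by
    intro P Q hPQ hP hQ
    obtain ⟨f, hf, hL⟩ := ln_rep (HasLines.mkLine (L := ProjLine F) hPQ)
    have hm := HasLines.mkLine_ax (L := ProjLine F) hPQ
    have hmem : ∀ R : ProjPoint F, R ∈ HasLines.mkLine (L := ProjLine F) hPQ ↔ f (v R) = 0 := by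
      intro R
      rw [mem_def, hL, hv R]
      simp
    refine ⟨f, (hmem P).1 hm.1, (hmem Q).1 hm.2, ?_⟩
    intro R hR hRP hRQ h0
    exact hRQ (nuc_unique hP hm.1 hR hQ.1 hRP hPQ.symm ((hmem R).2 h0) hm.2)
  obtain ⟨f₃, a1, a2, a3⟩ := key P₁ P₂ h12 h₁ h₂
  obtain ⟨f₂, b1, b3, b2⟩ := key P₁ P₃ h13 h₁ h₃
  obtain ⟨f₁, c2, c3, c1⟩ := key P₂ P₃ h23 h₂ h₃
  let A := Ω \ {P₁, P₂, P₃}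
  have hAc : A.card + 1 = Fintype.card F := by
    have hs : ({P₁, P₂, P₃} : Finset (ProjPoint F)) ⊆ Ω := by
      intro x hx
      simp only [Finset.mem_insert, Finset.mem_singleton] at hx
      rcases hx with rfl | rfl | rfl
      · exact h₁.1
      · exact h₂.1
      · exact h₃.1
    have h3 : ({P₁, P₂, P₃} : Finset (ProjPoint F)).card = 3 := Finset.card_eq_three.2
      ⟨P₁, P₂, P₃, h12, h13, h23, rfl⟩
    have := Finset.card_sdiff_add_card_eq_card hs
    have hpos : 1 < Fintype.card F := Fintype.one_lt_card
    simp only [A]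
    omega
  have hA : ∀ Q ∈ A, Q ∈ Ω ∧ Q ≠ P₁ ∧ Q ≠ P₂ ∧ Q ≠ P₃ := by
    intro Q hQ
    simpa [A] using hQ
  have s1 := segre_step h₁ v hv f₂ f₃ b1 a1 P₂ a2 (b2 P₂ h₂.1 h12.symm h23) A (fun Q hQ => by
    obtain ⟨q0, q1, q2, q3⟩ := hA Q hQ
    exact ⟨q0, q1, b2 Q q0 q1 q3, a3 Q q0 q1 q2⟩) hAc
  have s2 := segre_step h₂ v hv f₃ f₁ a2 c2 P₃ c3 (a3 P₃ h₃.1 h13.symm h23.symm) A (fun Q hQ => by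
    obtain ⟨q0, q1, q2, q3⟩ := hA Q hQ
    exact ⟨q0, q2, a3 Q q0 q1 q2, c1 Q q0 q2 q3⟩) hAc
  have s3 := segre_step h₃ v hv f₁ f₂ c3 b3 P₁ b1 (c1 P₁ h₁.1 h12 h13) A (fun Q hQ => by
    obtain ⟨q0, q1, q2, q3⟩ := hA Q hQ
    exact ⟨q0, q3, c1 Q q0 q2 q3, b2 Q q0 q1 q3⟩) hAc
  have hp : (∏ Q ∈ A, f₂ (v Q) / f₃ (v Q)) * (∏ Q ∈ A, f₃ (v Q) / f₁ (v Q)) *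
      (∏ Q ∈ A, f₁ (v Q) / f₂ (v Q)) = 1 := by
    rw [← Finset.prod_mul_distrib, ← Finset.prod_mul_distrib]
    apply Finset.prod_eq_one
    intro Q hQ
    obtain ⟨q0, q1, q2, q3⟩ := hA Q hQ
    have := b2 Q q0 q1 q3
    have := a3 Q q0 q1 q2
    have := c1 Q q0 q2 q3
    field_simp
  rw [s1, s2, s3] at hp
  have h2 : ringChar F ≠ 2 := by
    intro h
    have := FiniteField.even_card_of_char_two h
    rw [Nat.odd_iff] at hodd
    omega
  exact Ring.neg_one_ne_one_of_char_ne_two h2 (by linear_combination hp)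

section Counting

set_option linter.unusedSectionVars false

variable {P L : Type*} [Membership P L] [Fintype P] [Fintype L]

open Classical in
/-- Number of points of `Ω` on the line `l`. -/
noncomputable def num (Ω : Finset P) (l : L) : ℕ := (Ω.filter (fun p => p ∈ l)).card

open Classical in
/-- The lines through `Z`. -/
noncomputable def star (L : Type*) [Membership P L] [Fintype L] (Z : P) : Finset L :=
  Finset.univ.filter (fun l => Z ∈ l)

theorem mem_star {Z : P} {l : L} : l ∈ star L Z ↔ Z ∈ l := by simp [star]

variable [ProjectivePlane P L]

theorem star_sum (A : Finset P) (Z : P) (hZ : Z ∉ A) : ∑ l ∈ star L Z, num A l = A.card := by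
  classical
  unfold num
  simp only [Finset.card_filter]
  rw [Finset.sum_comm]
  rw [Finset.card_eq_sum_ones]
  refine Finset.sum_congr rfl ?_
  intro Q hQ
  rw [← Finset.card_filter, Finset.card_eq_one]
  have hne : Z ≠ Q := by rintro rfl; exact hZ hQ
  obtain ⟨l, hl, hu⟩ := HasLines.existsUnique_line P L Z Q hne
  refine ⟨l, ?_⟩
  ext m
  simp only [Finset.mem_filter, Finset.mem_singleton, mem_star]
  constructor
  · exact fun h => hu m h
  · rintro rfl
    exact hl

theorem num_erase [DecidableEq P] (Ω : Finset P) {Z : P} (hZ : Z ∈ Ω) {l : L} (hl : Z ∈ l) :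
    num Ω l = num (Ω.erase Z) l + 1 := by
  classical
  unfold num
  rw [Finset.filter_erase, Finset.card_erase_add_one]
  simp [hZ, hl]

theorem star_sum_mem (Ω : Finset P) (Z : P) (hZ : Z ∈ Ω) :
    ∑ l ∈ star L Z, num Ω l + 1 = Ω.card + (star L Z).card := by
  classical
  have h : ∑ l ∈ star L Z, num Ω l = ∑ l ∈ star L Z, (num (Ω.erase Z) l + 1) :=
    Finset.sum_congr rfl (fun l hl => num_erase Ω hZ (mem_star.1 hl))
  rw [h, Finset.sum_add_distrib, star_sum _ Z (by simp)]
  have := Finset.card_erase_add_one hZ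
  simp
  omega

theorem star_card_eq (Z W : P) : (star L Z).card = (star L W).card := by
  classical
  have h := ProjectivePlane.lineCount_eq_lineCount L Z W
  unfold lineCount at h
  rw [Nat.card_eq_fintype_card, Nat.card_eq_fintype_card, Fintype.card_subtype,
    Fintype.card_subtype] at h
  unfold star
  convert h

theorem star_card {q : ℕ} {Ω : Finset P} (hΩ : Ω.card = q + 2) {N : P} (hN : N ∈ Ω)
    (hnuc : ∀ l : L, N ∈ l → num Ω l = 2) (Z : P) : (star L Z).card = q + 1 := by
  rw [star_card_eq Z N]
  have h := star_sum_mem (L := L) Ω N hN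
  rw [Finset.sum_congr rfl (fun l hl => hnuc l (mem_star.1 hl))] at h
  simp at h
  omega

theorem weighted (Ω : Finset P) (w : L → ℕ) :
    ∑ l, num Ω l * w l = ∑ Z ∈ Ω, ∑ l ∈ star L Z, w l := by
  classical
  unfold num star
  simp only [Finset.card_filter, Finset.sum_mul, Finset.sum_filter]
  rw [Finset.sum_comm]
  simp

theorem num_pos {Ω : Finset P} {Z : P} (hZ : Z ∈ Ω) {l : L} (hl : Z ∈ l) : 0 < num Ω l := by
  classical
  unfold num
  exact Finset.card_pos.2 ⟨Z, by simp [hZ, hl]⟩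

theorem odd_cover {q : ℕ} (hq : Odd q) {Ω : Finset P} (hΩ : Ω.card = q + 2) {N : P} (hN : N ∈ Ω)
    (hnuc : ∀ l : L, N ∈ l → num Ω l = 2) (Z : P)
    (hZ : ∀ l : L, Z ∈ l → ¬ Odd (num Ω l)) :
    Z ∈ Ω ∧ ∀ l : L, Z ∈ l → num Ω l = 2 := by
  have hev : ∀ l : L, Z ∈ l → Even (num Ω l) := fun l hl => Nat.not_odd_iff_even.1 (hZ l hl)
  by_cases h : Z ∈ Ω
  · refine ⟨h, ?_⟩
    have hs := star_sum_mem (L := L) Ω Z h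
    rw [star_card hΩ hN hnuc Z, hΩ] at hs
    have h2 : ∀ l ∈ star L Z, 2 ≤ num Ω l := by
      intro l hl
      have h1 := num_pos h (mem_star.1 hl)
      obtain ⟨k, hk⟩ := hev l (mem_star.1 hl)
      omega
    have he : ∑ l ∈ star L Z, 2 = ∑ l ∈ star L Z, num Ω l := by
      rw [Finset.sum_const, star_card hΩ hN hnuc Z, smul_eq_mul]
      omega
    intro l hl
    exact ((Finset.sum_eq_sum_iff_of_le h2).1 he l (mem_star.2 hl)).symm
  · exfalso
    have hs := star_sum (L := L) Ω Z h
    have : Even (∑ l ∈ star L Z, num Ω l) :=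
      Finset.even_sum _ (fun l hl => hev l (mem_star.1 hl))
    rw [hs, hΩ] at this
    obtain ⟨a, ha⟩ := hq
    obtain ⟨b, hb⟩ := this
    omega

open Classical in
theorem count_main {q : ℕ} {Ω : Finset P} (hΩ : Ω.card = q + 2) {N : P} (hN : N ∈ Ω)
    (hnuc : ∀ l : L, N ∈ l → num Ω l = 2) :
    (Finset.univ.filter (fun l : L => Odd (num Ω l))).card + 2 * ((q + 1) * (q + 2)) ≤
      4 * (Finset.univ.filter (fun l : L => 0 < num Ω l)).card := by
  have t1 : ∑ l : L, num Ω l = (q + 1) * (q + 2) := by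
    have h := weighted (L := L) Ω (fun _ => 1)
    simp only [mul_one] at h
    rw [h]
    simp only [Finset.sum_const, smul_eq_mul, mul_one]
    rw [Finset.sum_congr rfl (fun Z _ => star_card hΩ hN hnuc Z), Finset.sum_const, hΩ, smul_eq_mul,
      mul_comm]
  have t2 : ∑ l : L, num Ω l * num Ω l = 2 * ((q + 1) * (q + 2)) := by
    rw [weighted (L := L) Ω (fun l => num Ω l)]
    have : ∀ Z ∈ Ω, ∑ l ∈ star L Z, num Ω l = 2 * (q + 1) := by
      intro Z hZ
      have h := star_sum_mem (L := L) Ω Z hZ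
      rw [star_card hΩ hN hnuc Z, hΩ] at h
      omega
    rw [Finset.sum_congr rfl this, Finset.sum_const, hΩ, smul_eq_mul]
    ring
  have hpt : ∀ l : L, (if Odd (num Ω l) then 1 else 0) + 4 * num Ω l ≤
      4 * (if 0 < num Ω l then 1 else 0) + num Ω l * num Ω l := by
    intro l
    generalize num Ω l = i
    by_cases h4 : 4 ≤ i
    · have : 4 * i ≤ i * i := Nat.mul_le_mul_right i h4
      split_ifs <;> omega
    · have : i < 4 := by omega
      interval_cases i <;> decide
  have hs := Finset.sum_le_sum (fun l (_ : l ∈ Finset.univ) => hpt l)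
  rw [Finset.sum_add_distrib, Finset.sum_add_distrib, ← Finset.mul_sum, ← Finset.mul_sum, t1, t2,
    ← Finset.card_filter, ← Finset.card_filter] at hs
  omega

end Counting

theorem nuc_iff (Ω : Finset (ProjPoint F)) (Z : ProjPoint F) :
    IsInternalNucleus (Ω : Set (ProjPoint F)) Z ↔
      Z ∈ Ω ∧ ∀ l : ProjLine F, Z ∈ l → num Ω l = 2 := by
  classical
  unfold IsInternalNucleus
  rw [Finset.mem_coe]
  refine and_congr_right fun hZ => forall_congr' fun l => forall_congr' fun hl => ?_
  have h1 : num Ω l = num (Ω.erase Z) l + 1 := by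
    unfold num
    rw [Finset.filter_erase, Finset.card_erase_add_one]
    rw [Finset.mem_filter]
    exact ⟨hZ, hl⟩
  have h2 : num Ω l = 2 ↔ num (Ω.erase Z) l = 1 := by omega
  rw [h2]
  unfold num
  rw [Finset.card_eq_one, Finset.singleton_iff_unique_mem]
  refine existsUnique_congr fun Q => ?_
  rw [Finset.mem_filter, Finset.mem_erase, Finset.mem_coe, mem_def]
  tauto

end Nuc

/-- For `q` an odd prime power and `Ω` a set of `q+2` points of `PG(2,q)` with
an internal nucleus, the number of lines meeting `Ω` is at least
`(q+1)(q+2)/2 + (q-1)/2`, i.e. twice that number is at least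
`(q+1)(q+2) + (q-1)`. -/
theorem intersecting_lines_lower_bound {F : Type*} [Field F] [Fintype F] (q : ℕ)
    (hq : Fintype.card F = q) (hodd : Odd q)
    (Ω : Set (ProjPoint F)) (hΩ : Ω.ncard = q + 2)
    (hnuc : ∃ P : ProjPoint F, IsInternalNucleus Ω P) :
    (q + 1) * (q + 2) + (q - 1) ≤
      2 * {L : ProjLine F | ∃ P ∈ Ω, P.1 ≤ L.1}.ncard := by
  classical
  have : Finite (Submodule F (Fin 3 → F)) := Finite.of_injective _ SetLike.coe_injective
  have := Fintype.ofFinite (ProjPoint F)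
  have := Fintype.ofFinite (ProjLine F)
  obtain ⟨Ω, rfl⟩ : ∃ Ω' : Finset (ProjPoint F), (Ω' : Set (ProjPoint F)) = Ω :=
    ⟨Ω.toFinite.toFinset, by simp⟩
  rw [Set.ncard_coe_finset] at hΩ
  obtain ⟨N, hN⟩ := hnuc
  have hN' := (Nuc.nuc_iff Ω N).1 hN
  have hcount := Nuc.count_main hΩ hN'.1 hN'.2
  have hset : {L : ProjLine F | ∃ P ∈ (Ω : Set (ProjPoint F)), P.1 ≤ L.1} =
      ((Finset.univ.filter (fun l : ProjLine F => 0 < Nuc.num Ω l) : Finset (ProjLine F)) :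
        Set (ProjLine F)) := by
    ext l
    simp only [Set.mem_ofPred_eq, Finset.coe_filter, Finset.mem_univ, true_and, Nuc.num,
      Finset.card_pos, Finset.filter_nonempty_iff]
    rfl
  rw [hset, Set.ncard_coe_finset]
  set O := Finset.univ.filter (fun l : ProjLine F => Odd (Nuc.num Ω l)) with hO
  have hNO : ∀ M, IsInternalNucleus (Ω : Set (ProjPoint F)) M → ∀ l ∈ O, M ∉ l := by
    intro M hM l hl hml
    have h2 := ((Nuc.nuc_iff Ω M).1 hM).2 l hml
    rw [hO, Finset.mem_filter, h2] at hl
    exact absurd hl.2 (by decide)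
  have hcov : ∀ Z : ProjPoint F, ¬ IsInternalNucleus (Ω : Set (ProjPoint F)) Z →
      ∃ l ∈ O, Z ∈ l := by
    intro Z hZ
    by_contra! h
    apply hZ
    rw [Nuc.nuc_iff]
    refine Nuc.odd_cover hodd hΩ hN'.1 hN'.2 Z ?_
    intro l hl ho
    exact h l (by simp [hO, ho]) hl
  have hmain : 2 * (q - 1) ≤ O.card := by
    subst hq
    -- there is a point that is not a nucleus
    by_cases hM : ∃ M, M ≠ N ∧ IsInternalNucleus (Ω : Set (ProjPoint F)) M
    · obtain ⟨M, hMN, hM⟩ := hM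
      have huniq : ∀ Z, IsInternalNucleus (Ω : Set (ProjPoint F)) Z → Z = N ∨ Z = M := by
        intro Z hZ
        by_contra! h
        exact Nuc.segre hodd Ω hΩ hN hM hZ hMN.symm h.1.symm h.2.symm
      obtain ⟨Z, hZ, hZ2⟩ : ∃ Z ∈ Ω, Z ∉ ({N, M} : Finset (ProjPoint F)) := by
        apply Finset.exists_mem_notMem_of_card_lt_card
        have := Finset.card_le_two (a := N) (b := M)
        have : 0 < Fintype.card F := Fintype.card_pos
        omega
      obtain ⟨l₀, hl₀, -⟩ := hcov Z (fun h => hZ2 (by simpa using huniq Z h))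
      -- a line through `M` missing `N`
      obtain ⟨m, hm, hNm⟩ : ∃ m : ProjLine F, M ∈ m ∧ N ∉ m := by
        obtain ⟨v, hv, hNv⟩ := Nuc.pt_rep N
        have hvM : v ∉ M.1 := by
          intro h
          have hle : N.1 ≤ M.1 := by
            rw [hNv]
            simpa using h
          exact hMN (Subtype.ext
            (Submodule.eq_of_le_of_finrank_eq hle (by rw [N.2, M.2])).symm)
        obtain ⟨f, hf, hMf⟩ := Submodule.exists_le_ker_of_notMem hvM
        have hf0 : f ≠ 0 := by
          rintro rfl
          simp at hf
        refine ⟨Nuc.mkLn f hf0, hMf, ?_⟩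
        rw [Nuc.mem_def, hNv]
        simpa [Nuc.mkLn] using hf
      have := Nuc.jamison (insert m (O.erase l₀)) N l₀ (hNO N hN l₀ hl₀) (by
        intro l hl
        rcases Finset.mem_insert.1 hl with rfl | hl
        · exact hNm
        · exact hNO N hN l (Finset.mem_of_mem_erase hl)) (by
        intro Z hZN hZl
        by_cases hZM : Z = M
        · exact ⟨m, by simp, hZM ▸ hm⟩
        · obtain ⟨l, hl, hZ⟩ := hcov Z (fun h => (huniq Z h).elim hZN hZM)
          refine ⟨l, ?_, hZ⟩
          refine Finset.mem_insert_of_mem (Finset.mem_erase.2 ⟨?_, hl⟩)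
          rintro rfl
          exact hZl hZ)
      have h1 := Finset.card_insert_le m (O.erase l₀)
      have h2 := Finset.card_erase_add_one hl₀
      omega
    · push Not at hM
      obtain ⟨Z, hZ, hZ2⟩ : ∃ Z ∈ Ω, Z ∉ ({N} : Finset (ProjPoint F)) := by
        apply Finset.exists_mem_notMem_of_card_lt_card
        simp
        omega
      obtain ⟨l₀, hl₀, -⟩ := hcov Z (hM Z (by simpa using hZ2))
      have := Nuc.jamison (O.erase l₀) N l₀ (hNO N hN l₀ hl₀) (by
        intro l hl
        exact hNO N hN l (Finset.mem_of_mem_erase hl)) (by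
        intro Z hZN hZl
        obtain ⟨l, hl, hZ⟩ := hcov Z (hM Z hZN)
        refine ⟨l, (Finset.mem_erase.2 ⟨?_, hl⟩), hZ⟩
        rintro rfl
        exact hZl hZ)
      have h2 := Finset.card_erase_add_one hl₀
      omega
  omega
end
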